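/- arXiv:1203.6675 — 5 statements merged into one kernel-verified Lean document; each statement's English description precedes it below -/
import Mathlib

section
/- Suppose Assumptions 1–4 hold and the inverse demand function p is convex. Define t = inf{q ≥ 0 : min_n C_n'(q) ≥ p(q) + q·∂₊p(q)}. Then the aggregate supply X of every Cournot candidate satisfies X ≥ t. -/
open Finset Set

noncomputable section

/-- Assumption 1: the cost function `C` (with derivative `C'`) is convex, continuous,
nondecreasing on `[0,∞)`, continuously differentiable on `(0,∞)`, has right derivative
`C' 0` at `0`, and `C 0 = 0`. -/
def CostAssumption (C C' : ℝ → ℝ) : Prop :=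
  ConvexOn ℝ (Set.Ici 0) C ∧
  ContinuousOn C (Set.Ici 0) ∧
  MonotoneOn C (Set.Ici 0) ∧
  (∀ x : ℝ, 0 < x → HasDerivAt C (C' x) x) ∧
  ContinuousOn C' (Set.Ioi 0) ∧
  HasDerivWithinAt C (C' 0) (Set.Ici 0) 0 ∧
  C 0 = 0

/-- Assumption 2: the inverse demand function `p` is continuous, nonnegative and
nonincreasing on `[0,∞)`, with `p 0 > 0`; `pr q` is the right derivative of `p`
at every `q ≥ 0` and `pl q` is the left derivative of `p` at every `q > 0`. -/
def DemandAssumption (p pl pr : ℝ → ℝ) : Prop :=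
  ContinuousOn p (Set.Ici 0) ∧
  (∀ q : ℝ, 0 ≤ q → 0 ≤ p q) ∧
  AntitoneOn p (Set.Ici 0) ∧
  0 < p 0 ∧
  HasDerivWithinAt p (pr 0) (Set.Ici 0) 0 ∧
  (∀ q : ℝ, 0 < q → HasDerivWithinAt p (pr q) (Set.Ici q) q) ∧
  (∀ q : ℝ, 0 < q → HasDerivWithinAt p (pl q) (Set.Iic q) q)

/-- The social welfare of the supply vector `x`. -/
def SW {N : ℕ} (C : Fin N → ℝ → ℝ) (p : ℝ → ℝ) (x : Fin N → ℝ) : ℝ :=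
  (∫ q in (0:ℝ)..(∑ n, x n), p q) - ∑ n, C n (x n)

/-- A social optimum: a nonnegative vector maximizing the social welfare. -/
def SocialOptimum {N : ℕ} (C : Fin N → ℝ → ℝ) (p : ℝ → ℝ) (x : Fin N → ℝ) : Prop :=
  (∀ n, 0 ≤ x n) ∧ ∀ y : Fin N → ℝ, (∀ n, 0 ≤ y n) → SW C p y ≤ SW C p x

/-- A Cournot candidate: a nonnegative vector satisfying the first-order necessary
conditions for a Cournot equilibrium. -/
def CournotCandidate {N : ℕ} (C' : Fin N → ℝ → ℝ) (p pl pr : ℝ → ℝ)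
    (x : Fin N → ℝ) : Prop :=
  (∀ n, 0 ≤ x n) ∧
  ∀ n, (0 < x n → C' n (x n) ≤ p (∑ m, x m) + x n * pl (∑ m, x m)) ∧
       p (∑ m, x m) + x n * pr (∑ m, x m) ≤ C' n (x n)

/-- A Cournot equilibrium: each supplier's quantity is a best response. -/
def CournotEquilibrium {N : ℕ} (C : Fin N → ℝ → ℝ) (p : ℝ → ℝ) (x : Fin N → ℝ) : Prop :=
  (∀ n, 0 ≤ x n) ∧
  ∀ n, ∀ z : ℝ, 0 ≤ z →
    z * p (z + ∑ m ∈ Finset.univ.erase n, x m) - C n z ≤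
      x n * p (x n + ∑ m ∈ Finset.univ.erase n, x m) - C n (x n)

/-- A monopoly output: a nonnegative vector maximizing total profit. -/
def MonopolyOutput {N : ℕ} (C : Fin N → ℝ → ℝ) (p : ℝ → ℝ) (x : Fin N → ℝ) : Prop :=
  (∀ n, 0 ≤ x n) ∧
  ∀ y : Fin N → ℝ, (∀ n, 0 ≤ y n) →
    p (∑ n, y n) * (∑ n, y n) - ∑ n, C n (y n) ≤
      p (∑ n, x n) * (∑ n, x n) - ∑ n, C n (x n)

/-- The quantity `φ` appearing in the efficiency bound `f`. -/
def phi (c : ℝ) : ℝ := max ((2 - c + Real.sqrt (c ^ 2 - 4 * c + 12)) / 2) 1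

/-- The efficiency lower bound `f(c̄) = (φ² + 2)/(φ² + 2φ + c̄)`. -/
def fbound (c : ℝ) : ℝ := (phi c ^ 2 + 2) / (phi c ^ 2 + 2 * phi c + c)

/-- The aggregate supply at every Cournot candidate is at least
`t = inf {q ≥ 0 : minₙ Cₙ'(q) ≥ p q + q ∂₊p(q)}`. -/
theorem cournot_candidate_supply_ge_t {N : ℕ} (hN : 0 < N)
    (C C' : Fin N → ℝ → ℝ) (p pl pr : ℝ → ℝ)
    (hC : ∀ n, CostAssumption (C n) (C' n))
    (hp : DemandAssumption p pl pr)
    (hA3 : ∃ R : ℝ, 0 < R ∧ ∀ n, p R ≤ C' n 0)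
    (hA4 : ∃ n, C' n 0 < p 0)
    (hconv : ConvexOn ℝ (Set.Ici 0) p)
    (t : ℝ)
    (ht : t = sInf {q : ℝ | 0 ≤ q ∧ p q + q * pr q ≤ ⨅ n, C' n q})
    (x : Fin N → ℝ) (hx : CournotCandidate C' p pl pr x) :
    t ≤ ∑ n, x n := by
  obtain ⟨hx0, hx1⟩ := hx
  have : Nonempty (Fin N) := ⟨⟨0, hN⟩⟩
  have hX0 : 0 ≤ ∑ n, x n := Finset.sum_nonneg fun n _ => hx0 n
  rw [ht]
  refine csInf_le ⟨0, fun q hq => hq.1⟩ ⟨hX0, le_ciInf fun n => ?_⟩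
  have hle : x n ≤ ∑ m, x m := Finset.single_le_sum (fun m _ => hx0 m) (Finset.mem_univ n)
  have h1 := (hx1 n).2
  generalize (∑ m, x m) = X at *
  obtain ⟨-, -, hanti, -, hr0, hr, -⟩ := hp
  have hd : HasDerivWithinAt p (pr X) (Set.Ici X) X := by
    rcases hX0.eq_or_lt with h | h
    · subst h; exact hr0
    · exact hr X h
  have hpr : pr X ≤ 0 := by
    refine HasDerivWithinAt.nonpos_of_antitoneOn ?_ hd
      (hanti.mono (Set.Ici_subset_Ici.2 hX0))
    rw [accPt_principal_iff_nhdsWithin]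
    have : Set.Ici X \ {X} = Set.Ioi X := by ext y; simp [lt_iff_le_and_ne, eq_comm]
    rw [this]
    infer_instance
  have h2 : X * pr X ≤ x n * pr X := mul_le_mul_of_nonpos_right hle hpr
  have h3 : C' n (x n) ≤ C' n X := by
    rcases hle.eq_or_lt with h | h
    · rw [h]
    obtain ⟨hc, -, -, hder, -, hder0, -⟩ := hC n
    have hXp : 0 < X := (hx0 n).trans_lt h
    have ha : HasDerivWithinAt (C n) (C' n (x n)) (Set.Ioi (x n)) (x n) := by
      rcases (hx0 n).eq_or_lt with h0 | h0
      · rw [← h0]; exact hder0.mono Set.Ioi_subset_Ici_self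
      · exact (hder _ h0).hasDerivWithinAt
    exact (hc.le_slope_of_hasDerivWithinAt_Ioi (hx0 n) hX0 h ha).trans
      (hc.slope_le_of_hasDerivAt (hx0 n) hX0 h (hder X hXp))
  linarith

end
end

section
/- Suppose Assumptions 1–4 hold and the inverse demand function p is convex. Let x^S be a social optimum and let x^P be a monopoly output, with aggregate supplies X^S and X^P respectively. (a) If p(X^P) = p(X^S), then γ(x^P) = 1. (b) If p(X^P) ≠ p(X^S), let c = |p'(X^P)|, d = |(p(X^S) − p(X^P))/(X^S − X^P)|, and c̄ = c/d; then c̄ ≥ 1 and γ(x^P) ≥ 3/(3 + c̄). -/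
open Finset Set

noncomputable section

open Filter Topology in
theorem subgrad {p : ℝ → ℝ} {x s q : ℝ} (hconv : ConvexOn ℝ (Set.Ici 0) p)
    (hx : 0 ≤ x) (hq : 0 ≤ q) (hd : HasDerivWithinAt p s (Set.Ici x) x) :
    p x + s * (q - x) ≤ p q := by
  have hd' : HasDerivWithinAt p s (Set.Ioi x) x := hd.mono Set.Ioi_subset_Ici_self
  rcases lt_trichotomy q x with h | h | h
  · have key : (p x - p q) / (x - q) ≤ s := by
      apply ge_of_tendsto ((hasDerivWithinAt_iff_tendsto_slope' Set.self_notMem_Ioi).mp hd')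
      filter_upwards [self_mem_nhdsWithin] with t ht
      have ht : x < t := ht
      rw [slope_def_field]
      exact hconv.slope_mono_adjacent hq (hx.trans ht.le) h ht
    rw [div_le_iff₀ (by linarith)] at key
    linarith
  · subst h; simp
  · have key := hconv.le_slope_of_hasDerivWithinAt_Ioi hx hq h hd'
    rw [slope_def_field, le_div_iff₀ (by linarith)] at key
    linarith

theorem p_int {p : ℝ → ℝ} (hc : ContinuousOn p (Set.Ici 0)) {a b : ℝ} (ha : 0 ≤ a) (hb : 0 ≤ b) :
    IntervalIntegrable p MeasureTheory.volume a b := by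
  apply ContinuousOn.intervalIntegrable
  apply hc.mono
  intro u hu
  exact (le_min ha hb).trans hu.1

theorem affine_int (A B a b : ℝ) :
    ∫ u in a..b, (A + B * u) = A * (b - a) + B * ((b ^ 2 - a ^ 2) / 2) := by
  rw [intervalIntegral.integral_add (by simp) (by apply Continuous.intervalIntegrable; fun_prop),
    intervalIntegral.integral_const_mul, integral_id]
  simp; ring

theorem affine_ii (A B a b : ℝ) :
    IntervalIntegrable (fun u => A + B * u) MeasureTheory.volume a b := by
  apply Continuous.intervalIntegrable; fun_prop

theorem int_ub {p : ℝ → ℝ} (hc : ContinuousOn p (Set.Ici 0)) (hanti : AntitoneOn p (Set.Ici 0))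
    {a b : ℝ} (ha : 0 ≤ a) (hb : 0 ≤ b) : ∫ u in a..b, p u ≤ p a * (b - a) := by
  rcases le_total a b with h | h
  · have := intervalIntegral.integral_mono_on h (p_int hc ha hb) (affine_ii (p a) 0 a b)
      (fun u hu => by
        have := hanti ha (ha.trans hu.1 : (0:ℝ) ≤ u) hu.1
        linarith)
    rw [affine_int] at this
    linarith
  · have := intervalIntegral.integral_mono_on h (affine_ii (p a) 0 b a) (p_int hc hb ha)
      (fun u hu => by
        have := hanti (hb.trans hu.1 : (0:ℝ) ≤ u) ha hu.2
        linarith)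
    rw [affine_int] at this
    rw [intervalIntegral.integral_symm]
    linarith

theorem int_lb {p : ℝ → ℝ} (hc : ContinuousOn p (Set.Ici 0)) (hanti : AntitoneOn p (Set.Ici 0))
    {a b : ℝ} (ha : 0 ≤ a) (hb : 0 ≤ b) : p b * (b - a) ≤ ∫ u in a..b, p u := by
  have := int_ub hc hanti hb ha
  rw [intervalIntegral.integral_symm] at this
  linarith

/-- convexity of total cost along a segment -/
theorem seg_cost {N : ℕ} {C : Fin N → ℝ → ℝ} (hC : ∀ n, ConvexOn ℝ (Set.Ici 0) (C n))
    {x y : Fin N → ℝ} (hx : ∀ n, 0 ≤ x n) (hy : ∀ n, 0 ≤ y n) {t : ℝ} (ht0 : 0 ≤ t) (ht1 : t ≤ 1) :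
    ∑ n, C n ((1 - t) * x n + t * y n) ≤
      ∑ n, C n (x n) + t * (∑ n, C n (y n) - ∑ n, C n (x n)) := by
  have : ∑ n, C n ((1 - t) * x n + t * y n) ≤ ∑ n, ((1 - t) * C n (x n) + t * C n (y n)) := by
    apply Finset.sum_le_sum
    intro n _
    exact (hC n).2 (hx n) (hy n) (by linarith : (0:ℝ) ≤ 1 - t) ht0 (by ring)
  rw [Finset.sum_add_distrib, ← Finset.mul_sum, ← Finset.mul_sum] at this
  linarith

theorem seg_sum {N : ℕ} (x y : Fin N → ℝ) (t : ℝ) :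
    ∑ n, ((1 - t) * x n + t * y n) = ∑ n, x n + t * (∑ n, y n - ∑ n, x n) := by
  rw [Finset.sum_add_distrib, ← Finset.mul_sum, ← Finset.mul_sum]; ring

theorem seg_nonneg {N : ℕ} {x y : Fin N → ℝ} (hx : ∀ n, 0 ≤ x n) (hy : ∀ n, 0 ≤ y n) {t : ℝ}
    (ht0 : 0 ≤ t) (ht1 : t ≤ 1) (n : Fin N) : 0 ≤ (1 - t) * x n + t * y n :=
  add_nonneg (mul_nonneg (by linarith) (hx n)) (mul_nonneg ht0 (hy n))

open Filter Topology in
theorem mono_foc {N : ℕ} {C : Fin N → ℝ → ℝ} {p : ℝ → ℝ} {x y : Fin N → ℝ} {s : ℝ}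
    (hC : ∀ n, ConvexOn ℝ (Set.Ici 0) (C n))
    (hM : MonopolyOutput C p x) (hy : ∀ n, 0 ≤ y n)
    (hs : ∀ q, 0 ≤ q → p (∑ n, x n) + s * (q - ∑ n, x n) ≤ p q) :
    (p (∑ n, x n) + s * ∑ n, x n) * (∑ n, y n - ∑ n, x n) ≤
      ∑ n, C n (y n) - ∑ n, C n (x n) := by
  obtain ⟨hx, hmax⟩ := hM
  set P := ∑ n, x n
  set h := ∑ n, y n - P with hh
  have lim : Tendsto (fun t : ℝ => (p P + s * P) * h + t * (h ^ 2 * s)) (𝓝[>] 0)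
      (𝓝 ((p P + s * P) * h + 0 * (h ^ 2 * s))) := by
    apply Tendsto.mono_left _ nhdsWithin_le_nhds
    apply Continuous.tendsto
    fun_prop
  rw [zero_mul, add_zero] at lim
  apply le_of_tendsto lim
  filter_upwards [Ioo_mem_nhdsGT (zero_lt_one' ℝ)] with t ht
  have ht0 := ht.1
  have nn := seg_nonneg hx hy ht.1.le ht.2.le
  have h1 := hmax (fun n => (1 - t) * x n + t * y n) nn
  have h2 := seg_cost hC hx hy ht.1.le ht.2.le
  have h3 : 0 ≤ ∑ n, ((1 - t) * x n + t * y n) := Finset.sum_nonneg (fun n _ => nn n)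
  simp only [seg_sum] at h1 h3
  change p (P + t * h) * (P + t * h) - _ ≤ p P * P - _ at h1
  change 0 ≤ P + t * h at h3
  have h4 := mul_le_mul_of_nonneg_right (hs _ h3) h3
  have h5 : t * ((p P + s * P) * h + t * (h ^ 2 * s)) ≤
      t * (∑ n, C n (y n) - ∑ n, C n (x n)) := by
    nlinarith
  exact le_of_mul_le_mul_left h5 ht0

open Filter Topology in
theorem soc_foc {N : ℕ} {C : Fin N → ℝ → ℝ} {p : ℝ → ℝ} {x y : Fin N → ℝ}
    (hC : ∀ n, ConvexOn ℝ (Set.Ici 0) (C n))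
    (hc : ContinuousOn p (Set.Ici 0)) (hanti : AntitoneOn p (Set.Ici 0))
    (hM : SocialOptimum C p x) (hy : ∀ n, 0 ≤ y n) :
    p (∑ n, x n) * (∑ n, y n - ∑ n, x n) ≤
      ∑ n, C n (y n) - ∑ n, C n (x n) := by
  obtain ⟨hx, hmax⟩ := hM
  have hP : 0 ≤ ∑ n, x n := Finset.sum_nonneg (fun n _ => hx n)
  set P := ∑ n, x n
  set h := ∑ n, y n - P with hh
  have pos : ∀ t ∈ Set.Ioo (0:ℝ) 1, 0 ≤ P + t * h := by
    intro t ht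
    have h3 : 0 ≤ ∑ n, ((1 - t) * x n + t * y n) :=
      Finset.sum_nonneg (fun n _ => seg_nonneg hx hy ht.1.le ht.2.le n)
    rwa [seg_sum] at h3
  have lim0 : Tendsto (fun t : ℝ => P + t * h) (𝓝[>] 0) (𝓝[Set.Ici 0] P) := by
    apply tendsto_nhdsWithin_of_tendsto_nhds_of_eventually_within
    · apply Tendsto.mono_left _ nhdsWithin_le_nhds
      have : Continuous (fun t : ℝ => P + t * h) := by fun_prop
      simpa using this.tendsto 0
    · filter_upwards [Ioo_mem_nhdsGT (zero_lt_one' ℝ)] with t ht using pos t ht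
  have lim : Tendsto (fun t : ℝ => p (P + t * h) * h) (𝓝[>] 0) (𝓝 (p P * h)) :=
    (Tendsto.comp (hc P hP) lim0).mul_const h
  apply le_of_tendsto lim
  filter_upwards [Ioo_mem_nhdsGT (zero_lt_one' ℝ)] with t ht
  have ht0 := ht.1
  have h1 := hmax (fun n => (1 - t) * x n + t * y n) (seg_nonneg hx hy ht.1.le ht.2.le)
  have h2 := seg_cost hC hx hy ht.1.le ht.2.le
  simp only [SW, seg_sum] at h1
  change (∫ q in (0:ℝ)..(P + t * h), p q) - _ ≤ (∫ q in (0:ℝ)..P, p q) - _ at h1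
  have h3 := pos t ht
  have h4 := intervalIntegral.integral_add_adjacent_intervals
    (p_int hc le_rfl hP) (p_int hc hP h3)
  have h5 := int_lb hc hanti hP h3
  have h6 : t * (p (P + t * h) * h) ≤ t * (∑ n, C n (y n) - ∑ n, C n (x n)) := by
    nlinarith
  exact le_of_mul_le_mul_left h6 ht0

open Filter Topology in
theorem soc_pos {N : ℕ} {C C' : Fin N → ℝ → ℝ} {p : ℝ → ℝ} {x : Fin N → ℝ}
    (hC : ∀ n, CostAssumption (C n) (C' n))
    (hc : ContinuousOn p (Set.Ici 0)) (hanti : AntitoneOn p (Set.Ici 0))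
    (hA4 : ∃ n, C' n 0 < p 0)
    (hM : SocialOptimum C p x) : 0 < SW C p x := by
  obtain ⟨n, hn⟩ := hA4
  obtain ⟨-, -, -, -, -, hd, h0⟩ := hC n
  have l1 : Tendsto (slope (C n) 0) (𝓝[>] 0) (𝓝 (C' n 0)) :=
    (hasDerivWithinAt_iff_tendsto_slope' Set.self_notMem_Ioi).mp (hd.mono Set.Ioi_subset_Ici_self)
  have l2 : Tendsto p (𝓝[>] 0) (𝓝 (p 0)) :=
    Tendsto.mono_left (hc 0 Set.self_mem_Ici) (nhdsWithin_mono _ Set.Ioi_subset_Ici_self)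
  obtain ⟨t, hlt, ht⟩ := ((l1.eventually_lt l2 hn).and self_mem_nhdsWithin).exists
  have ht : 0 < t := ht
  rw [slope_def_field, h0, sub_zero, sub_zero, div_lt_iff₀ ht] at hlt
  refine lt_of_lt_of_le ?_ (hM.2 (Pi.single n t) ?_)
  · have e1 : ∑ m, (Pi.single n t : Fin N → ℝ) m = t := by simp
    have e2 : ∑ m, C m ((Pi.single n t : Fin N → ℝ) m) = C n t := by
      rw [Finset.sum_eq_single n]
      · simp
      · intro m _ hm
        rw [Pi.single_eq_of_ne hm]
        exact (hC m).2.2.2.2.2.2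
      · simp
    have := int_lb hc hanti le_rfl ht.le
    unfold SW
    rw [e1, e2]
    linarith
  · intro m
    by_cases h : m = n
    · subst h; simp [ht.le]
    · simp [h]

theorem trap {p : ℝ → ℝ} (hc : ContinuousOn p (Set.Ici 0)) (hconv : ConvexOn ℝ (Set.Ici 0) p)
    {a b : ℝ} (ha : 0 ≤ a) (hab : a < b) :
    ∫ u in a..b, p u ≤ (p a + p b) / 2 * (b - a) := by
  have hb : 0 ≤ b := ha.trans hab.le
  have hba : 0 < b - a := by linarith
  obtain ⟨k, hk⟩ : ∃ k, k = (p b - p a) / (b - a) := ⟨_, rfl⟩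
  have hk' : k * (b - a) = p b - p a := by rw [hk]; field_simp
  have := intervalIntegral.integral_mono_on hab.le (p_int hc ha hb) (affine_ii (p a - k * a) k a b)
    (fun u hu => by
      have h := hconv.2 ha hb (div_nonneg (by linarith [hu.2] : (0:ℝ) ≤ b - u) hba.le)
        (div_nonneg (by linarith [hu.1] : (0:ℝ) ≤ u - a) hba.le) (by field_simp; ring)
      simp only [smul_eq_mul] at h
      have e : (b - u) / (b - a) * a + (u - a) / (b - a) * b = u := by field_simp; ring
      have e2 : (b - u) / (b - a) * p a + (u - a) / (b - a) * p b = p a - k * a + k * u := by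
        rw [hk]; field_simp; ring
      rwa [e, e2] at h)
  rw [affine_int] at this
  have e3 : (p a - k * a) * (b - a) + k * ((b ^ 2 - a ^ 2) / 2) = (p a + p b) / 2 * (b - a) := by
    linear_combination (b - a) / 2 * hk'
  linarith

/-- Efficiency of a monopoly output under convex inverse demand: efficiency one if
the prices coincide, and at least `3/(3 + c̄)` otherwise. -/
theorem monopoly_output_efficiency {N : ℕ} (hN : 0 < N)
    (C C' : Fin N → ℝ → ℝ) (p pl pr : ℝ → ℝ)
    (hC : ∀ n, CostAssumption (C n) (C' n))
    (hp : DemandAssumption p pl pr)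
    (hA3 : ∃ R : ℝ, 0 < R ∧ ∀ n, p R ≤ C' n 0)
    (hA4 : ∃ n, C' n 0 < p 0)
    (hconv : ConvexOn ℝ (Set.Ici 0) p)
    (xS xP : Fin N → ℝ)
    (hxS : SocialOptimum C p xS)
    (hxP : MonopolyOutput C p xP) :
    (p (∑ n, xP n) = p (∑ n, xS n) → SW C p xP / SW C p xS = 1) ∧
    (p (∑ n, xP n) ≠ p (∑ n, xS n) →
      ∀ c d : ℝ, c = |pr (∑ n, xP n)| →
        d = |(p (∑ n, xS n) - p (∑ n, xP n)) / ((∑ n, xS n) - ∑ n, xP n)| →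
        1 ≤ c / d ∧ 3 / (3 + c / d) ≤ SW C p xP / SW C p xS) := by
  obtain ⟨hc, hpn, hanti, hp0, hpr0, hpr, hpl⟩ := hp
  have hCc : ∀ n, ConvexOn ℝ (Set.Ici 0) (C n) := fun n => (hC n).1
  have hWS := soc_pos hC hc hanti hA4 hxS
  have hP : 0 ≤ ∑ n, xP n := Finset.sum_nonneg (fun n _ => hxP.1 n)
  have hS : 0 ≤ ∑ n, xS n := Finset.sum_nonneg (fun n _ => hxS.1 n)
  have hle := hxS.2 xP hxP.1
  have hmm := hxP.2 xS hxS.1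
  have hdr : HasDerivWithinAt p (pr (∑ n, xP n)) (Set.Ici (∑ n, xP n)) (∑ n, xP n) := by
    rcases hP.eq_or_lt with h | h
    · rw [← h]; exact hpr0
    · exact hpr _ h
  have hsub : ∀ q, 0 ≤ q → p (∑ n, xP n) + pr (∑ n, xP n) * (q - ∑ n, xP n) ≤ p q :=
    fun q hq => subgrad hconv hP hq hdr
  have f1 := mono_foc hCc hxP hxS.1 hsub
  have f2 := mono_foc hCc hxP (y := fun _ => 0) (fun _ => le_rfl) hsub
  have f3 := soc_foc hCc hc hanti hxS hxP.1
  have hz : ∑ n, C n 0 = 0 := Finset.sum_eq_zero (fun n _ => (hC n).2.2.2.2.2.2)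
  simp only [Finset.sum_const_zero, hz] at f2
  have hadd := intervalIntegral.integral_add_adjacent_intervals
    (p_int hc le_rfl hP) (p_int hc hP hS)
  have hsw1 : SW C p xP = (∫ q in (0:ℝ)..(∑ n, xP n), p q) - ∑ n, C n (xP n) := rfl
  have hsw2 : SW C p xS = (∫ q in (0:ℝ)..(∑ n, xS n), p q) - ∑ n, C n (xS n) := rfl
  have hub := int_ub hc hanti hP hS
  generalize SW C p xP = WP at *
  generalize SW C p xS = WS at *
  generalize ∑ n, C n (xP n) = KP at *
  generalize ∑ n, C n (xS n) = KS at *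
  generalize ∑ n, xP n = P at *
  generalize ∑ n, xS n = S at *
  constructor
  · intro heq
    rw [div_eq_one_iff_eq hWS.ne']
    rw [← heq] at hmm
    linarith
  · intro hne c d hcdef hddef
    have hs0 : pr P ≤ 0 := by
      have := hsub (P + 1) (by linarith)
      have := hanti (a := P) (b := P + 1) hP (by simp; linarith) (by linarith)
      linarith
    rw [abs_of_nonpos hs0] at hcdef
    have hprc : pr P = -c := by linarith
    rw [hprc] at hsub f1 f2 hs0
    have hc0 : 0 ≤ c := by linarith
    have hPS : P < S := by
      by_contra hcon
      push Not at hcon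
      have h1 := hanti hS hP hcon
      have h2 : p P < p S := lt_of_le_of_ne h1 hne
      have h3 : P ≠ S := fun h => hne (by rw [h])
      have h4 : 0 < P - S := sub_pos.2 (lt_of_le_of_ne hcon h3.symm)
      nlinarith [mul_pos h4 (sub_pos.2 h2), mul_nonneg h4.le (mul_nonneg hc0 hP)]
    have hpp : p S < p P := lt_of_le_of_ne (hanti hP hS hPS.le) hne.symm
    have hh : 0 < S - P := by linarith
    have hdv : d = (p P - p S) / (S - P) := by
      rw [hddef, abs_of_nonpos (div_nonpos_of_nonpos_of_nonneg (by linarith) hh.le)]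
      ring
    have hd0 : 0 < d := by rw [hdv]; exact div_pos (by linarith) hh
    have hdh : d * (S - P) = p P - p S := by rw [hdv]; field_simp
    have hcd : d ≤ c := by
      have := hsub S hS
      nlinarith
    have hc1 : 0 < c := by linarith
    have hPpos : 0 < P := by
      rcases hP.eq_or_lt with h | h
      · exfalso
        subst h
        nlinarith
      · exact h
    have hWP : 3 * c * P ^ 2 / 2 ≤ WP := by
      have := intervalIntegral.integral_mono_on hP (affine_ii (p P + c * P) (-c) 0 P)
        (p_int hc le_rfl hP) (fun u hu => by linarith [hsub u hu.1])
      rw [affine_int] at this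
      nlinarith
    have hdiff : WS - WP ≤ (S - P) * (c * P - d * (S - P) / 2) := by
      have := trap hc hconv hP hPS
      have e : p S = p P - d * (S - P) := by linarith
      rw [e] at this
      nlinarith
    refine ⟨(one_le_div hd0).2 hcd, ?_⟩
    rw [div_le_div_iff₀ (by positivity) hWS]
    have k1 : WS - WP ≤ c ^ 2 * P ^ 2 / (2 * d) := by
      refine hdiff.trans ?_
      rw [le_div_iff₀ (by positivity)]
      nlinarith [sq_nonneg (c * P - d * (S - P))]
    have k2 : 3 * (c ^ 2 * P ^ 2 / (2 * d)) ≤ WP * (c / d) := by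
      have : 3 * (c ^ 2 * P ^ 2 / (2 * d)) = 3 * c * P ^ 2 / 2 * (c / d) := by
        field_simp
      rw [this]
      exact mul_le_mul_of_nonneg_right hWP (by positivity)
    linarith

end
end

section
/- Suppose Assumptions 1–4 hold and the inverse demand function p is convex. Define s = inf{q ≥ 0 : p(q) = min_n C_n'(0)} and t = inf{q ≥ 0 : min_n C_n'(q) ≥ p(q) + q·∂₊p(q)}. If ∂₋p(s) < 0, then every monopoly output x^P satisfies γ(x^P) ≥ ∂₋p(s)/(3·∂₋p(s) + ∂₊p(t)), i.e., γ(x^P) ≥ 3/(3 + ∂₊p(t)/∂₋p(s)). -/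
open Finset Set

noncomputable section

set_option maxHeartbeats 1000000

lemma right_max_aux {f : ℝ → ℝ} {f' a : ℝ} (h : HasDerivWithinAt f f' (Set.Ici a) a)
    (hm : ∀ x, a < x → f x ≤ f a) : f' ≤ 0 := by
  have h1 := (hasDerivWithinAt_iff_tendsto_slope' Set.self_notMem_Ioi).mp (h.mono Set.Ioi_subset_Ici_self)
  refine le_of_tendsto h1 ?_
  filter_upwards [self_mem_nhdsWithin] with x hx
  have hx' : a < x := hx
  rw [slope_def_field]
  exact div_nonpos_of_nonpos_of_nonneg (by linarith [hm x hx']) (by linarith)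

lemma left_max_aux {f : ℝ → ℝ} {f' a b : ℝ} (h : HasDerivWithinAt f f' (Set.Iic a) a) (hb : b < a)
    (hm : ∀ x, b < x → x < a → f x ≤ f a) : 0 ≤ f' := by
  have h1 := (hasDerivWithinAt_iff_tendsto_slope' Set.self_notMem_Iio).mp (h.mono Set.Iio_subset_Iic_self)
  refine ge_of_tendsto h1 ?_
  filter_upwards [self_mem_nhdsWithin, mem_nhdsWithin_of_mem_nhds (Ioi_mem_nhds hb)] with x hx hx2
  have hx' : x < a := hx
  rw [slope_def_field]
  exact div_nonneg_of_nonpos (by linarith [hm x hx2 hx']) (by linarith)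

lemma conv_right {f : ℝ → ℝ} {f' x y : ℝ} (hf : ConvexOn ℝ (Set.Ici 0) f) (hx : 0 ≤ x)
    (hxy : x ≤ y) (h : HasDerivWithinAt f f' (Set.Ici x) x) : f x + f' * (y - x) ≤ f y := by
  rcases hxy.eq_or_lt with rfl | hlt
  · simp
  have := hf.le_slope_of_hasDerivWithinAt_Ioi (Set.mem_Ici.2 hx) (Set.mem_Ici.2 (hx.trans hxy)) hlt
    (h.mono Set.Ioi_subset_Ici_self)
  rw [slope_def_field, le_div_iff₀ (by linarith)] at this
  linarith

lemma conv_left {f : ℝ → ℝ} {f' x y : ℝ} (hf : ConvexOn ℝ (Set.Ici 0) f) (hx : 0 ≤ x)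
    (hxy : x ≤ y) (h : HasDerivWithinAt f f' (Set.Iic y) y) : f y - f' * (y - x) ≤ f x := by
  rcases hxy.eq_or_lt with rfl | hlt
  · simp
  have := hf.slope_le_of_hasDerivWithinAt_Iio (Set.mem_Ici.2 hx) (Set.mem_Ici.2 (hx.trans hxy)) hlt
    (h.mono Set.Iio_subset_Iic_self)
  rw [slope_def_field, div_le_iff₀ (by linarith)] at this
  linarith

lemma left_le_right {f : ℝ → ℝ} {l r x : ℝ} (hf : ConvexOn ℝ (Set.Ici 0) f) (hx : 0 < x)
    (hl : HasDerivWithinAt f l (Set.Iic x) x) (hr : HasDerivWithinAt f r (Set.Ici x) x) : l ≤ r := by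
  have := hf.leftDeriv_le_rightDeriv_of_mem_interior (x := x) (by simpa using hx)
  rwa [(hl.mono Set.Iio_subset_Iic_self).derivWithin (uniqueDiffWithinAt_Iio x),
    (hr.mono Set.Ioi_subset_Ici_self).derivWithin (uniqueDiffWithinAt_Ioi x)] at this

lemma cost_right {C C' : ℝ → ℝ} (h : CostAssumption C C') {x : ℝ} (hx : 0 ≤ x) :
    HasDerivWithinAt C (C' x) (Set.Ici x) x := by
  obtain ⟨-, -, -, hd, -, h0, -⟩ := h
  rcases hx.eq_or_lt with rfl | hlt
  · exact h0
  · exact (hd x hlt).hasDerivWithinAt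

lemma cost_tangent {C C' : ℝ → ℝ} (h : CostAssumption C C') {x y : ℝ} (hx : 0 ≤ x) (hy : 0 ≤ y) :
    C x + C' x * (y - x) ≤ C y := by
  rcases le_total x y with hxy | hxy
  · exact conv_right h.1 hx hxy (cost_right h hx)
  · rcases hx.eq_or_lt with rfl | hlt
    · have : y = 0 := le_antisymm hxy hy
      subst this; simp
    · have := conv_left h.1 hy hxy ((h.2.2.2.1 x hlt).hasDerivWithinAt)
      linarith

lemma cost_mono {C C' : ℝ → ℝ} (h : CostAssumption C C') {x y : ℝ} (hx : 0 ≤ x) (hxy : x ≤ y) :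
    C' x ≤ C' y := by
  rcases hxy.eq_or_lt with rfl | hlt
  · rfl
  have h1 := cost_tangent h hx (hx.trans hxy)
  have h2 := cost_tangent h (hx.trans hxy) hx
  have : 0 ≤ (C' y - C' x) * (y - x) := by linarith
  have := nonneg_of_mul_nonneg_left this (by linarith)
  linarith

lemma demand_right {p pl pr : ℝ → ℝ} (h : DemandAssumption p pl pr) {x : ℝ} (hx : 0 ≤ x) :
    HasDerivWithinAt p (pr x) (Set.Ici x) x := by
  obtain ⟨-, -, -, -, h0, hd, -⟩ := h
  rcases hx.eq_or_lt with rfl | hlt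
  · exact h0
  · exact hd x hlt

lemma mono_coord {N : ℕ} {C : Fin N → ℝ → ℝ} {p : ℝ → ℝ} {x : Fin N → ℝ}
    (h : MonopolyOutput C p x) (n : Fin N) {u : ℝ} (hu : (∑ m, x m) - x n ≤ u) :
    p u * u - C n (x n + (u - ∑ m, x m)) ≤
      p (∑ m, x m) * (∑ m, x m) - C n (x n + ((∑ m, x m) - ∑ m, x m)) := by
  have hx := h.1
  have := h.2 (Function.update x n (x n + (u - ∑ m, x m))) (by
    intro m
    by_cases hm : m = n
    · subst hm; simp; linarith
    · simp [hm, hx m])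
  have e1 : ∑ m, Function.update x n (x n + (u - ∑ m, x m)) m = u := by
    rw [Finset.sum_update_of_mem (Finset.mem_univ n), ← Finset.erase_eq]
    have := Finset.add_sum_erase Finset.univ x (Finset.mem_univ n)
    linarith
  have e2 : ∑ m, C m (Function.update x n (x n + (u - ∑ m, x m)) m) =
      C n (x n + (u - ∑ m, x m)) + ∑ m ∈ Finset.univ.erase n, C m (x m) := by
    rw [← Finset.add_sum_erase _ _ (Finset.mem_univ n)]
    congr 1
    · simp
    · refine Finset.sum_congr rfl fun m hm => ?_
      rw [Function.update_of_ne (Finset.ne_of_mem_erase hm)]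
  have e3 := Finset.add_sum_erase Finset.univ (fun m => C m (x m)) (Finset.mem_univ n)
  rw [e1, e2] at this
  simp only [sub_self, add_zero]
  linarith

lemma foc_right {N : ℕ} {C C' : Fin N → ℝ → ℝ} {p pl pr : ℝ → ℝ}
    (hC : ∀ n, CostAssumption (C n) (C' n)) (hp : DemandAssumption p pl pr) {x : Fin N → ℝ}
    (h : MonopolyOutput C p x) (n : Fin N) :
    p (∑ m, x m) + (∑ m, x m) * pr (∑ m, x m) ≤ C' n (x n) := by
  have hX : 0 ≤ ∑ m, x m := Finset.sum_nonneg fun m _ => h.1 m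
  have hc : HasDerivWithinAt (fun u => C n (x n + (u - ∑ m, x m))) (C' n (x n) * 1)
      (Set.Ici (∑ m, x m)) (∑ m, x m) := by
    have h2 : HasDerivWithinAt (C n) (C' n (x n)) (Set.Ici (x n)) (x n + ((∑ m, x m) - ∑ m, x m)) := by
      simpa using cost_right (hC n) (h.1 n)
    refine HasDerivWithinAt.comp (h := fun u => x n + (u - ∑ m, x m)) _ h2 ?_ ?_
    · exact ((hasDerivWithinAt_id _ _).sub_const _).const_add _
    · intro u hu
      have : ∑ m, x m ≤ u := hu
      simp only [Set.mem_Ici]; linarith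
  have hF := ((demand_right hp hX).mul (hasDerivWithinAt_id _ _)).sub hc
  have := right_max_aux hF (fun u hu => by
    have := mono_coord h n (u := u) (by linarith [h.1 n])
    simpa using this)
  simp only [id] at this
  linarith

lemma foc_left {N : ℕ} {C C' : Fin N → ℝ → ℝ} {p pl pr : ℝ → ℝ}
    (hC : ∀ n, CostAssumption (C n) (C' n)) (hp : DemandAssumption p pl pr) {x : Fin N → ℝ}
    (h : MonopolyOutput C p x) (n : Fin N) (hn : 0 < x n) :
    C' n (x n) ≤ p (∑ m, x m) + (∑ m, x m) * pl (∑ m, x m) := by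
  have hX : 0 < ∑ m, x m :=
    hn.trans_le (Finset.single_le_sum (fun m _ => h.1 m) (Finset.mem_univ n))
  have hc : HasDerivWithinAt (fun u => C n (x n + (u - ∑ m, x m))) (C' n (x n) * 1)
      (Set.Iic (∑ m, x m)) (∑ m, x m) := by
    have h2 : HasDerivAt (C n) (C' n (x n)) (x n + ((∑ m, x m) - ∑ m, x m)) := by
      simpa using (hC n).2.2.2.1 (x n) hn
    refine HasDerivAt.comp_hasDerivWithinAt (h := fun u => x n + (u - ∑ m, x m)) _ h2 ?_
    exact ((hasDerivWithinAt_id _ _).sub_const _).const_add _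
  have hF := ((hp.2.2.2.2.2.2 _ hX).mul (hasDerivWithinAt_id _ _)).sub hc
  have := left_max_aux (b := (∑ m, x m) - x n) hF (by linarith) (fun u hu _ => by
    have := mono_coord h n (u := u) (by linarith [h.1 n])
    simpa using this)
  simp only [id] at this
  linarith


/-- Efficiency lower bound for monopoly outputs in terms of `s` and `t`:
`γ(x^P) ≥ ∂₋p(s)/(3 ∂₋p(s) + ∂₊p(t))`, i.e. `γ(x^P) ≥ 3/(3 + ∂₊p(t)/∂₋p(s))`. -/
theorem monopoly_efficiency_bound_st {N : ℕ} (hN : 0 < N)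
    (C C' : Fin N → ℝ → ℝ) (p pl pr : ℝ → ℝ)
    (hC : ∀ n, CostAssumption (C n) (C' n))
    (hp : DemandAssumption p pl pr)
    (hA3 : ∃ R : ℝ, 0 < R ∧ ∀ n, p R ≤ C' n 0)
    (hA4 : ∃ n, C' n 0 < p 0)
    (hconv : ConvexOn ℝ (Set.Ici 0) p)
    (s t : ℝ)
    (hs : s = sInf {q : ℝ | 0 ≤ q ∧ p q = ⨅ n, C' n 0})
    (ht : t = sInf {q : ℝ | 0 ≤ q ∧ p q + q * pr q ≤ ⨅ n, C' n q})
    (hpls : pl s < 0) :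
    ∀ xP xS : Fin N → ℝ, MonopolyOutput C p xP → SocialOptimum C p xS →
      pl s / (3 * pl s + pr t) ≤ SW C p xP / SW C p xS ∧
      3 / (3 + pr t / pl s) ≤ SW C p xP / SW C p xS := by
  intro xP xS hM hS
  have : Nonempty (Fin N) := ⟨⟨0, hN⟩⟩
  have hpc := hp.1
  have hanti := hp.2.2.1
  set X := ∑ n, xP n with hXdef
  set Y := ∑ n, xS n with hYdef
  have hX0 : 0 ≤ X := Finset.sum_nonneg fun m _ => hM.1 m
  have hY0 : 0 ≤ Y := Finset.sum_nonneg fun m _ => hS.1 m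
  have hfr := foc_right hC hp hM
  have hfl := foc_left hC hp hM
  rw [← hXdef] at hfr hfl
  obtain ⟨k, hk⟩ := hA4
  -- total output is positive
  have hXpos : 0 < X := by
    rcases hX0.eq_or_lt with h0 | h0
    · exfalso
      have hxk : xP k = 0 := le_antisymm
        (by rw [h0]; exact Finset.single_le_sum (fun m _ => hM.1 m) (Finset.mem_univ k)) (hM.1 k)
      have := hfr k
      rw [hxk, ← h0] at this
      linarith
    · exact h0
  have hlr : pl X ≤ pr X :=
    left_le_right hconv hXpos (hp.2.2.2.2.2.2 X hXpos) (demand_right hp hX0)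
  obtain ⟨j, hj⟩ : ∃ j, 0 < xP j := by
    by_contra hcon
    push Not at hcon
    have : X ≤ 0 := Finset.sum_nonpos fun m _ => hcon m
    linarith
  have heq : pl X = pr X := by
    refine le_antisymm hlr ?_
    have := (hfr j).trans (hfl j hj)
    exact le_of_mul_le_mul_left (by linarith) hXpos
  have hprX : pr X ≤ 0 := right_max_aux (demand_right hp hX0) fun u hu =>
    hanti (Set.mem_Ici.2 hX0) (Set.mem_Ici.2 (hX0.trans hu.le)) hu.le
  obtain ⟨d, hd⟩ : ∃ d, pr X = -d := ⟨-pr X, by ring⟩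
  have hd0 : 0 ≤ d := by linarith
  obtain ⟨α, hα⟩ : ∃ α, α = p X - X * d := ⟨_, rfl⟩
  have hα1 : ∀ n, α ≤ C' n (xP n) := fun n => by have := hfr n; rw [hd] at this; linarith
  have hα2 : ∀ n, 0 < xP n → C' n (xP n) ≤ α := fun n hn => by
    have := hfl n hn; rw [heq, hd] at this; linarith
  -- s
  have hs_mem : 0 ≤ s ∧ p s = ⨅ n, C' n 0 := by
    obtain ⟨R, hR, hR2⟩ := hA3
    have hne : ({q : ℝ | 0 ≤ q ∧ p q = ⨅ n, C' n 0}).Nonempty := by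
      have hi := intermediate_value_Icc' hR.le (hpc.mono Set.Icc_subset_Ici_self)
      obtain ⟨q, hq, hq2⟩ := hi (show (⨅ n, C' n 0) ∈ Set.Icc (p R) (p 0) from
        ⟨le_ciInf hR2, (ciInf_le (Set.finite_range _).bddBelow k).trans hk.le⟩)
      exact ⟨q, hq.1, hq2⟩
    have hcl : IsClosed {q : ℝ | 0 ≤ q ∧ p q = ⨅ n, C' n 0} :=
      hpc.preimage_isClosed_of_isClosed isClosed_Ici (isClosed_singleton (x := ⨅ n, C' n 0))
    have := hcl.csInf_mem hne ⟨0, fun q hq => hq.1⟩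
    rwa [← hs] at this
  obtain ⟨hs0, hps⟩ := hs_mem
  have hmin : ∀ n, p s ≤ C' n 0 := fun n => by
    rw [hps]; exact ciInf_le (Set.finite_range _).bddBelow n
  have hspos : 0 < s := by
    rcases hs0.eq_or_lt with h0 | h0
    · exfalso; have := hmin k; rw [← h0] at this; linarith
    · exact h0
  have hpsα : p s ≤ α :=
    (hmin j).trans ((cost_mono (hC j) le_rfl hj.le).trans (hα2 j hj))
  obtain ⟨m, hm⟩ : ∃ m, pl s = -m := ⟨-pl s, by ring⟩
  have hm0 : 0 < m := by linarith
  -- t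
  have htset : X ∈ {q : ℝ | 0 ≤ q ∧ p q + q * pr q ≤ ⨅ n, C' n q} := by
    refine ⟨hX0, le_ciInf fun n => (hfr n).trans (cost_mono (hC n) (hM.1 n) ?_)⟩
    exact Finset.single_le_sum (fun m _ => hM.1 m) (Finset.mem_univ n)
  have ht0 : 0 ≤ t := by rw [ht]; exact Real.sInf_nonneg fun q hq => hq.1
  have htX : t ≤ X := by rw [ht]; exact csInf_le ⟨0, fun q hq => hq.1⟩ htset
  have hprt : pr t ≤ -d := by
    rcases htX.eq_or_lt with h | h
    · rw [h, hd]
    · have h1 := conv_right hconv ht0 htX (demand_right hp ht0)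
      have h2 := conv_left hconv ht0 htX (hp.2.2.2.2.2.2 X hXpos)
      rw [heq, hd] at h2
      exact le_of_mul_le_mul_right (by linarith) (sub_pos.2 h)
  -- integrability
  have hint : ∀ a b : ℝ, 0 ≤ a → 0 ≤ b → IntervalIntegrable p MeasureTheory.volume a b := by
    intro a b ha hb
    refine (hpc.mono ?_).intervalIntegrable
    intro q hq
    exact (le_min ha hb).trans hq.1
  -- welfare at the monopoly output
  have hcostP : ∑ n, C n (xP n) ≤ α * X := by
    rw [hXdef, Finset.mul_sum]
    refine Finset.sum_le_sum fun n _ => ?_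
    have h1 := cost_tangent (hC n) (hM.1 n) le_rfl
    rw [(hC n).2.2.2.2.2.2] at h1
    rcases (hM.1 n).eq_or_lt with h | h
    · rw [← h, (hC n).2.2.2.2.2.2]; simp
    · have := mul_le_mul_of_nonneg_right (hα2 n h) h.le
      linarith
  have hI1 : p X * X + d * X ^ 2 / 2 ≤ ∫ q in (0:ℝ)..X, p q := by
    have hm1 : ∫ q in (0:ℝ)..X, (p X + d * X - d * q) ≤ ∫ q in (0:ℝ)..X, p q := by
      refine intervalIntegral.integral_mono_on hX0
        (Continuous.intervalIntegrable (by fun_prop) _ _) (hint 0 X le_rfl hX0) ?_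
      intro q hq
      have := conv_left hconv hq.1 hq.2 (hp.2.2.2.2.2.2 X hXpos)
      rw [heq, hd] at this
      linarith
    rw [intervalIntegral.integral_sub (by simp) (Continuous.intervalIntegrable (by fun_prop) _ _),
      intervalIntegral.integral_const_mul, integral_id] at hm1
    simp at hm1
    linarith
  have hWP : 3 / 2 * d * X ^ 2 ≤ SW C p xP := by
    unfold SW
    rw [← hXdef]
    have : α * X = p X * X - d * X ^ 2 := by rw [hα]; ring
    linarith
  have hWPpos : 0 < SW C p xP := by
    by_contra hcon
    push Not at hcon
    unfold SW at hcon
    rw [← hXdef] at hcon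
    have hprof : p X * X - ∑ n, C n (xP n) ≤ 0 := by
      have : 0 ≤ d * X ^ 2 := by positivity
      linarith
    have hz : MonopolyOutput C p (fun _ => 0) := by
      refine ⟨fun _ => le_rfl, fun y hy => ?_⟩
      have := hM.2 y hy
      have e : ∑ n, C n 0 = 0 := Finset.sum_eq_zero fun n _ => (hC n).2.2.2.2.2.2
      simp only [Finset.sum_const_zero, mul_zero, e]
      rw [← hXdef] at this
      linarith
    have := foc_right hC hp hz k
    simp at this
    linarith
  have hWSP := hS.2 xP hM.1
  have hWSpos : 0 < SW C p xS := hWPpos.trans_le hWSP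
  -- difference of welfares
  have hcostS : ∑ n, C n (xP n) + α * (Y - X) ≤ ∑ n, C n (xS n) := by
    rw [hXdef, hYdef, ← Finset.sum_sub_distrib, Finset.mul_sum, ← Finset.sum_add_distrib]
    refine Finset.sum_le_sum fun n _ => ?_
    have h1 := cost_tangent (hC n) (hM.1 n) (hS.1 n)
    rcases (hM.1 n).eq_or_lt with h | h
    · have h2 := mul_le_mul_of_nonneg_right (hα1 n) (hS.1 n)
      rw [← h] at h1 h2 ⊢
      linarith
    · have h3 : α = C' n (xP n) := le_antisymm (hα1 n) (hα2 n h)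
      rw [h3]; exact h1
  have hdiff : SW C p xS - SW C p xP ≤ (∫ q in X..Y, p q) - α * (Y - X) := by
    unfold SW
    rw [← hXdef, ← hYdef]
    have := intervalIntegral.integral_add_adjacent_intervals
      (hint 0 X le_rfl hX0) (hint X Y hX0 hY0)
    linarith
  have hpXα : α ≤ p X := by
    have : 0 ≤ X * d := by positivity
    linarith
  have hup : ∀ a b c : ℝ, 0 ≤ a → a ≤ b → (∀ q, a ≤ q → q ≤ b → p q ≤ c) →
      ∫ q in a..b, p q ≤ c * (b - a) := by
    intro a b c ha hab hc
    have : ∫ q in a..b, p q ≤ ∫ q in a..b, c :=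
      intervalIntegral.integral_mono_on hab (hint a b ha (ha.trans hab)) (by simp)
        (fun q hq => hc q hq.1 hq.2)
    simp at this
    linarith
  -- linear bound between X and s
  have hlin : ∀ b, X ≤ b → b ≤ s → (∫ q in X..b, p q) - α * (b - X) ≤ (X * d) ^ 2 / (2 * m) := by
    intro b hXb hbs
    have hm1 : ∫ q in X..b, p q ≤ ∫ q in X..b, (p X + m * X - m * q) := by
      refine intervalIntegral.integral_mono_on hXb (hint X b hX0 (hX0.trans hXb))
        (Continuous.intervalIntegrable (by fun_prop) _ _) ?_
      intro q hq
      rcases hq.1.eq_or_lt with h | h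
      · rw [← h]; linarith
      have h2 := conv_left hconv hX0 (hXb.trans hbs) (hp.2.2.2.2.2.2 s hspos)
      rw [hm] at h2
      have hXs : X < s := h.trans_le (hq.2.trans hbs)
      have h3 := hconv.secant_mono (a := X) (x := q) (y := s) (Set.mem_Ici.2 hX0)
        (Set.mem_Ici.2 (hX0.trans hq.1)) (Set.mem_Ici.2 hs0) h.ne' hXs.ne' (hq.2.trans hbs)
      have h4 : (p s - p X) / (s - X) ≤ -m := by
        rw [div_le_iff₀ (by linarith)]; linarith
      have h5 := h3.trans h4
      rw [div_le_iff₀ (by linarith)] at h5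
      linarith
    rw [intervalIntegral.integral_sub (by simp) (Continuous.intervalIntegrable (by fun_prop) _ _),
      intervalIntegral.integral_const_mul, integral_id] at hm1
    simp at hm1
    rw [le_div_iff₀ (by positivity)]
    have : (∫ q in X..b, p q) - α * (b - X) ≤ X * d * (b - X) - m * (b - X) ^ 2 / 2 := by
      rw [hα]; linarith
    have h2 := mul_le_mul_of_nonneg_right this (show 0 ≤ 2 * m by positivity)
    nlinarith [sq_nonneg (X * d - m * (b - X))]
  have hD : (∫ q in X..Y, p q) - α * (Y - X) ≤ (X * d) ^ 2 / (2 * m) := by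
    have hnn : 0 ≤ (X * d) ^ 2 / (2 * m) := by positivity
    rcases le_total Y X with hYX | hXY
    · have h1 : ∫ q in Y..X, α ≤ ∫ q in Y..X, p q :=
        intervalIntegral.integral_mono_on hYX (by simp) (hint Y X hY0 hX0)
          (fun q hq => hpXα.trans (hanti (Set.mem_Ici.2 (hY0.trans hq.1)) (Set.mem_Ici.2 hX0) hq.2))
      rw [intervalIntegral.integral_symm Y X]
      simp at h1
      linarith
    · have htail : ∀ q, s ≤ q → p q ≤ α := fun q hq =>
        (hanti (Set.mem_Ici.2 hs0) (Set.mem_Ici.2 (hs0.trans hq)) hq).trans hpsα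
      rcases le_total Y s with hYs | hsY
      · exact hlin Y hXY hYs
      · rcases le_total X s with hXs | hsX
        · have h1 := hlin s hXs le_rfl
          have h2 := hup s Y α hs0 hsY (fun q hq _ => htail q hq)
          have := intervalIntegral.integral_add_adjacent_intervals
            (hint X s hX0 hs0) (hint s Y hs0 hY0)
          linarith
        · have h2 := hup X Y α hX0 hXY (fun q hq _ => htail q (hsX.trans hq))
          linarith
  -- conclusion
  obtain ⟨c, hc⟩ : ∃ c, pr t / pl s = c := ⟨_, rfl⟩
  have hcm : d ≤ c * m := by
    rw [← hc, hm]; field_simp; linarith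
  have hc0 : 0 ≤ c := nonneg_of_mul_nonneg_left (hd0.trans hcm) hm0
  have hD2 : (X * d) ^ 2 / (2 * m) ≤ c * d * X ^ 2 / 2 := by
    rw [div_le_iff₀ (by positivity)]
    have := mul_le_mul_of_nonneg_right hcm (show 0 ≤ d * X ^ 2 by positivity)
    linarith
  have hmain : 3 / (3 + c) ≤ SW C p xP / SW C p xS := by
    rw [div_le_div_iff₀ (by linarith) hWSpos]
    have := mul_le_mul_of_nonneg_left hWP hc0
    linarith
  rw [hc]
  refine ⟨?_, hmain⟩
  have e : pl s / (3 * pl s + pr t) = 1 / (3 + c) := by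
    have hpr : pr t = c * pl s := by rw [← hc, div_mul_cancel₀ _ hpls.ne]
    have h3 : 3 + c ≠ 0 := by linarith
    have h4 : pl s ≠ 0 := hpls.ne
    rw [hpr, ← add_mul]
    field_simp
  rw [e]
  refine le_trans ?_ hmain
  gcongr
  norm_num

end
end

section
/- Suppose Assumptions 1, 3 and 4 hold, and the inverse demand function is p(q) = max{α − β·q^δ, 0} with α, β > 0 and 0 < δ ≤ 1. Then every Cournot equilibrium x satisfies γ(x) ≥ f((δ+1)^{(1−δ)/δ}). -/
open Finset Set

noncomputable section

lemma aux_tangent {δ a b : ℝ} (hδ0 : 0 < δ) (hδ1 : δ ≤ 1) (ha : 0 ≤ a) (hb : 0 < b) :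
    a ^ δ ≤ b ^ δ + δ * b ^ (δ - 1) * (a - b) := by
  have h1 : (1 + (a / b - 1)) ^ δ ≤ 1 + δ * (a / b - 1) := by
    apply rpow_one_add_le_one_add_mul_self _ hδ0.le hδ1
    have : 0 ≤ a / b := by positivity
    linarith
  have h2 : (1 + (a / b - 1)) = a / b := by ring
  rw [h2, Real.div_rpow ha hb.le] at h1
  have hbp : 0 < b ^ δ := Real.rpow_pos_of_pos hb δ
  rw [div_le_iff₀ hbp] at h1
  have h3 : b ^ (δ - 1) = b ^ δ / b := by
    rw [Real.rpow_sub hb, Real.rpow_one]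
  rw [h3]
  calc a ^ δ ≤ _ := h1
    _ = _ := by field_simp

lemma aux_gap {δ X q : ℝ} (hδ0 : 0 < δ) (hδ1 : δ ≤ 1) (hX : 0 < X) (hq : X ≤ q)
    (h : q ^ δ ≤ (1 + δ) * X ^ δ) :
    δ * X ^ (δ - 1) * (q - X) ≤ (δ + 1) ^ ((1 - δ) / δ) * (q ^ δ - X ^ δ) := by
  have hq0 : 0 < q := lt_of_lt_of_le hX hq
  have h1 := aux_tangent hδ0 hδ1 hX.le hq0
  have he : 0 ≤ (1 - δ) / δ := by apply div_nonneg <;> linarith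
  have h2 : (q ^ δ) ^ ((1 - δ) / δ) ≤ ((1 + δ) * X ^ δ) ^ ((1 - δ) / δ) :=
    Real.rpow_le_rpow (by positivity) h he
  have he2 : δ * ((1 - δ) / δ) = 1 - δ := by field_simp
  rw [Real.mul_rpow (by positivity) (by positivity), ← Real.rpow_mul hq0.le,
    ← Real.rpow_mul hX.le, he2, add_comm 1 δ] at h2
  set K := (δ + 1) ^ ((1 - δ) / δ) with hK
  have hKpos : 0 < K := by positivity
  have e1 : X ^ (δ - 1) * X ^ (1 - δ) = 1 := by
    rw [← Real.rpow_add hX]; simp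
  have e2 : q ^ (δ - 1) * q ^ (1 - δ) = 1 := by
    rw [← Real.rpow_add hq0]; simp
  have hXp : 0 < X ^ (δ - 1) := by positivity
  have hqp : 0 < q ^ (δ - 1) := by positivity
  have h3 : X ^ (δ - 1) ≤ K * q ^ (δ - 1) := by
    calc X ^ (δ - 1) = X ^ (δ - 1) * (q ^ (δ - 1) * q ^ (1 - δ)) := by rw [e2, mul_one]
      _ = (X ^ (δ - 1) * q ^ (δ - 1)) * q ^ (1 - δ) := by ring
      _ ≤ (X ^ (δ - 1) * q ^ (δ - 1)) * (K * X ^ (1 - δ)) := by gcongr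
      _ = K * q ^ (δ - 1) * (X ^ (δ - 1) * X ^ (1 - δ)) := by ring
      _ = K * q ^ (δ - 1) := by rw [e1, mul_one]
  calc δ * X ^ (δ - 1) * (q - X) ≤ δ * (K * q ^ (δ - 1)) * (q - X) := by
        have : 0 ≤ q - X := by linarith
        gcongr
    _ = K * (δ * q ^ (δ - 1) * (q - X)) := by ring
    _ ≤ K * (q ^ δ - X ^ δ) := by
        apply mul_le_mul_of_nonneg_left _ hKpos.le
        linarith

lemma aux_phi {c : ℝ} (hc : 0 < c) : 1 ≤ phi c ∧ 0 ≤ fbound c ∧ fbound c ≤ 1 := by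
  have h1 : 1 ≤ phi c := le_max_right _ _
  have hd : 0 < phi c ^ 2 + 2 * phi c + c := by positivity
  refine ⟨h1, ?_, ?_⟩
  · unfold fbound; positivity
  · unfold fbound
    rw [div_le_one hd]; linarith

lemma aux_f {c X m : ℝ} (hc : 0 < c) (hm : 0 < m) (hmX : m ≤ X) :
    fbound c * (X ^ 2 + 2 * m * X + c * m ^ 2) ≤ X ^ 2 + 2 * m ^ 2 := by
  obtain ⟨h1, -, -⟩ := aux_phi hc
  have hd : 0 < phi c ^ 2 + 2 * phi c + c := by positivity
  unfold fbound
  rw [div_mul_eq_mul_div, div_le_iff₀ hd]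
  have hs0 : 0 ≤ c ^ 2 - 4 * c + 12 := by nlinarith [sq_nonneg (c - 2)]
  have hs := Real.sq_sqrt hs0
  have hsn := Real.sqrt_nonneg (c ^ 2 - 4 * c + 12)
  set r := Real.sqrt (c ^ 2 - 4 * c + 12) with hr
  suffices H : 0 ≤ (X - phi c * m) * (2 * phi c * X + (c - 2) * (X + phi c * m) - 4 * m) by
    nlinarith [H]
  rcases le_total 1 ((2 - c + r) / 2) with h | h
  · have hphi : phi c = (2 - c + r) / 2 := by unfold phi; rw [max_eq_left h]
    have hr2 : r = 2 * phi c - 2 + c := by rw [hphi]; ring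
    rw [hr2] at hs
    have hq : phi c ^ 2 + (c - 2) * phi c - 2 = 0 := by nlinarith
    have : (X - phi c * m) * (2 * phi c * X + (c - 2) * (X + phi c * m) - 4 * m)
        = (X - phi c * m) ^ 2 * r + 2 * m * (X - phi c * m) * (phi c ^ 2 + (c - 2) * phi c - 2) := by
      rw [hr2]; ring
    rw [this, hq]
    have := mul_nonneg (sq_nonneg (X - phi c * m)) hsn
    linarith
  · have hphi : phi c = 1 := by unfold phi; rw [max_eq_right h]
    have hrc : r ≤ c := by linarith
    have hc3 : 3 ≤ c := by nlinarith
    rw [hphi]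
    apply mul_nonneg
    · linarith
    · nlinarith

lemma aux_foc {C g : ℝ → ℝ} {g' a z : ℝ} (hconv : ConvexOn ℝ (Set.Ici 0) C)
    (ha : 0 ≤ a) (hz : 0 ≤ z) (hopt : ∀ y, 0 ≤ y → g y - C y ≤ g a - C a)
    (hg : HasDerivAt g g' a) : C a + g' * (z - a) ≤ C z := by
  have hd : HasDerivAt (fun t : ℝ => g (a + t * (z - a))) (g' * (z - a)) 0 := by
    have h1 : HasDerivAt (fun t : ℝ => a + t * (z - a)) (z - a) 0 := by
      simpa using ((hasDerivAt_id (0:ℝ)).mul_const (z - a)).const_add a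
    have h2 : HasDerivAt g g' (a + 0 * (z - a)) := by simpa using hg
    exact HasDerivAt.comp (0:ℝ) h2 h1
  have ht := hd.tendsto_slope_zero_right
  have : g' * (z - a) ≤ C z - C a := by
    refine le_of_tendsto ht ?_
    have : Set.Ioo (0:ℝ) 1 ∈ nhdsWithin (0:ℝ) (Set.Ioi 0) := Ioo_mem_nhdsGT one_pos
    filter_upwards [this] with t ht
    obtain ⟨ht0, ht1⟩ := ht
    have hy : a + t * (z - a) = (1 - t) • a + t • z := by simp only [smul_eq_mul]; ring
    have hc := hconv.2 (Set.mem_Ici.2 ha) (Set.mem_Ici.2 hz) (by linarith : 0 ≤ 1 - t) ht0.le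
      (by ring)
    rw [← hy] at hc
    simp only [smul_eq_mul] at hc
    have ho := hopt (a + t * (z - a)) (by nlinarith)
    simp only [zero_add, zero_mul, add_zero, smul_eq_mul]
    rw [inv_mul_le_iff₀ ht0]
    linarith
  linarith

lemma aux_integral {g : ℝ → ℝ} (hg : Continuous g) {X S a k : ℝ} (ha : 0 ≤ a) (hk : 0 ≤ k)
    (hlow : ∀ q, 0 ≤ q → q ≤ X → 0 ≤ g q) (hS : 0 ≤ S)
    (hup : ∀ q, X ≤ q → g q ≤ max (k * (X + a - q)) 0) :
    ∫ q in X..S, g q ≤ k * a ^ 2 / 2 := by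
  have hka : 0 ≤ k * a ^ 2 / 2 := by positivity
  have hint : ∀ T, ∫ q in X..T, k * (X + a - q) = k * (a ^ 2 - (X + a - T) ^ 2) / 2 := by
    intro T
    rw [intervalIntegral.integral_const_mul, intervalIntegral.integral_sub (by simp) (by simp)]
    simp
    ring
  have hgi : ∀ u v, IntervalIntegrable g MeasureTheory.volume u v :=
    fun u v => hg.intervalIntegrable u v
  have hli : ∀ u v, IntervalIntegrable (fun q => k * (X + a - q)) MeasureTheory.volume u v :=
    fun u v => Continuous.intervalIntegrable (by fun_prop) u v
  have key : ∀ T, X ≤ T → T ≤ X + a → ∫ q in X..T, g q ≤ k * a ^ 2 / 2 := by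
    intro T h1 h2
    have := intervalIntegral.integral_mono_on h1 (hgi X T) (hli X T) (fun q hq => by
      have h3 := hup q hq.1
      rwa [max_eq_left (mul_nonneg hk (by linarith [hq.2]))] at h3)
    rw [hint] at this
    have : 0 ≤ k * (X + a - T) ^ 2 := by positivity
    linarith
  rcases le_total S X with h | h
  · rw [intervalIntegral.integral_symm]
    have : 0 ≤ ∫ q in S..X, g q :=
      intervalIntegral.integral_nonneg h (fun q hq => hlow q (by linarith [hq.1]) hq.2)
    linarith
  rcases le_total S (X + a) with h2 | h2
  · exact key S h h2
  · rw [← intervalIntegral.integral_add_adjacent_intervals (hgi X (X + a)) (hgi (X + a) S)]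
    have h3 := key (X + a) (by linarith) le_rfl
    have h4 : ∫ q in (X + a)..S, g q ≤ 0 := by
      have := intervalIntegral.integral_mono_on h2 (hgi _ _)
        (Continuous.intervalIntegrable (continuous_const (y := (0:ℝ))) _ _) (fun q hq => by
        have h3 := hup q (by linarith [hq.1])
        rwa [max_eq_right (mul_nonpos_of_nonneg_of_nonpos hk (by linarith [hq.1]))] at h3)
      simpa using this
    linarith

lemma aux_zero {C : ℝ → ℝ} {C0 : ℝ} {p : ℝ → ℝ} (hp : Continuous p) (hC0 : C 0 = 0)
    (hC : HasDerivWithinAt C C0 (Set.Ici 0) 0) (h : ∀ z, 0 ≤ z → z * p z - C z ≤ 0) :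
    p 0 ≤ C0 := by
  have h1 : HasDerivWithinAt C C0 (Set.Ioi 0) 0 := hC.mono Set.Ioi_subset_Ici_self
  rw [hasDerivWithinAt_iff_tendsto_slope' (by simp)] at h1
  have h2 : Filter.Tendsto p (nhdsWithin 0 (Set.Ioi 0)) (nhds (p 0)) :=
    (hp.tendsto 0).mono_left nhdsWithin_le_nhds
  refine le_of_tendsto_of_tendsto h2 h1 ?_
  filter_upwards [self_mem_nhdsWithin] with z hz
  have hz : 0 < z := hz
  have := h z hz.le
  rw [slope_def_field, hC0, sub_zero, sub_zero, le_div_iff₀ hz]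
  linarith

/-- Efficiency bound for the inverse demand `p(q) = max (α - β q^δ) 0` with
`0 < δ ≤ 1`: every Cournot equilibrium has efficiency at least
`f((δ+1)^((1-δ)/δ))`. -/
theorem efficiency_bound_power_demand {N : ℕ} (hN : 0 < N)
    (C C' : Fin N → ℝ → ℝ) (α β δ : ℝ)
    (hα : 0 < α) (hβ : 0 < β) (hδ0 : 0 < δ) (hδ1 : δ ≤ 1)
    (hC : ∀ n, CostAssumption (C n) (C' n))
    (p : ℝ → ℝ) (hp : p = fun q => max (α - β * q ^ δ) 0)
    (hA3 : ∃ R : ℝ, 0 < R ∧ ∀ n, p R ≤ C' n 0)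
    (hA4 : ∃ n, C' n 0 < p 0)
    (x : Fin N → ℝ) (hx : CournotEquilibrium C p x) :
    ∀ xS : Fin N → ℝ, SocialOptimum C p xS →
      fbound ((δ + 1) ^ ((1 - δ) / δ)) ≤ SW C p x / SW C p xS := by
  intro xS hxS
  obtain ⟨hx0, hxo⟩ := hx
  obtain ⟨hs0, hso⟩ := hxS
  set K := (δ + 1) ^ ((1 - δ) / δ) with hK
  have hKpos : 0 < K := by positivity
  obtain ⟨-, hf0, hf1⟩ := aux_phi hKpos
  have hpc : Continuous p := by
    rw [hp]
    have := Real.continuous_rpow_const hδ0.le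
    fun_prop
  have hpq : ∀ q, p q = max (α - β * q ^ δ) 0 := fun q => by rw [hp]
  have hp0 : p 0 = α := by
    rw [hpq, Real.zero_rpow hδ0.ne', mul_zero, sub_zero, max_eq_left hα.le]
  have hpn : ∀ q, 0 ≤ p q := fun q => by rw [hpq]; exact le_max_right _ _
  have hpge : ∀ q, α - β * q ^ δ ≤ p q := fun q => by rw [hpq]; exact le_max_left _ _
  have hanti : ∀ a b, 0 ≤ a → a ≤ b → p b ≤ p a := by
    intro a b ha hab
    rw [hpq, hpq]
    have := Real.rpow_le_rpow ha hab hδ0.le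
    gcongr
  have hpi : ∀ u v, IntervalIntegrable p MeasureTheory.volume u v :=
    fun u v => hpc.intervalIntegrable u v
  have hers : ∀ n, ∑ m ∈ Finset.univ.erase n, x m = (∑ m, x m) - x n := by
    intro n
    rw [← Finset.add_sum_erase _ _ (Finset.mem_univ n)]; ring
  have hX0 : 0 ≤ ∑ m, x m := Finset.sum_nonneg (fun n _ => hx0 n)
  have hS0 : 0 ≤ ∑ m, xS m := Finset.sum_nonneg (fun n _ => hs0 n)
  have hle : SW C p x ≤ SW C p xS := hso x hx0
  suffices H : 0 < SW C p x ∧ fbound K * SW C p xS ≤ SW C p x by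
    rw [le_div_iff₀ (lt_of_lt_of_le H.1 hle)]
    exact H.2
  have hCn : ∀ n z, 0 ≤ z → 0 ≤ C n z := by
    intro n z hz
    obtain ⟨-, -, hmono, -, -, -, h0⟩ := hC n
    rw [← h0]
    exact hmono (Set.mem_Ici.2 le_rfl) (Set.mem_Ici.2 hz) hz
  have hXpos : 0 < ∑ m, x m := by
    rcases hX0.lt_or_eq with h | h
    · exact h
    exfalso
    obtain ⟨n, hn⟩ := hA4
    have hall : ∀ m, x m = 0 := fun m =>
      (Finset.sum_eq_zero_iff_of_nonneg (fun n _ => hx0 n)).1 h.symm m (Finset.mem_univ m)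
    obtain ⟨-, -, -, -, -, hd, h0⟩ := hC n
    have := aux_zero hpc h0 hd (fun z hz => by
      have := hxo n z hz
      rw [hers, ← h, hall n, h0] at this
      simpa using this)
    linarith
  have hSWS : SW C p xS ≤ ∫ q in (0:ℝ)..(∑ n, xS n), p q := by
    unfold SW
    have : 0 ≤ ∑ n, C n (xS n) := Finset.sum_nonneg (fun n _ => hCn n _ (hs0 n))
    linarith
  generalize hXdef : ∑ m, x m = X at *
  generalize hSdef : ∑ m, xS m = S at *
  rcases (hpn X).eq_or_lt with hPX | hPX
  · -- zero price
    have hc0 : ∑ n, C n (x n) ≤ 0 := by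
      apply Finset.sum_nonpos
      intro n _
      have := hxo n 0 le_rfl
      obtain ⟨-, -, -, -, -, -, h0⟩ := hC n
      rw [hers, h0, add_sub_cancel, ← hPX] at this
      linarith
    have hSWx : ∫ q in (0:ℝ)..X, p q ≤ SW C p x := by
      unfold SW; rw [hXdef]; linarith
    have hpos : 0 < ∫ q in (0:ℝ)..X, p q :=
      intervalIntegral.integral_pos hXpos hpc.continuousOn (fun q _ => hpn q)
        ⟨0, ⟨le_rfl, hX0⟩, by rw [hp0]; exact hα⟩
    have hI : ∫ q in X..S, p q ≤ 0 := by
      have := aux_integral hpc (X := X) (S := S) (a := 0) (k := 0) le_rfl le_rfl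
        (fun q _ _ => hpn q) hS0 (fun q hq => by
          have := hanti X q hX0 hq
          rw [← hPX] at this
          exact this.trans (le_max_right _ _))
      simpa using this
    have hsplit := intervalIntegral.integral_add_adjacent_intervals (hpi 0 X) (hpi X S)
    have hposx : 0 < SW C p x := by linarith
    refine ⟨hposx, ?_⟩
    have h1 : SW C p xS ≤ SW C p x := by linarith
    nlinarith
  · -- positive price
    have hP : p X = α - β * X ^ δ := by
      rw [hpq] at hPX ⊢
      rcases lt_max_iff.1 hPX with h | h
      · exact max_eq_left h.le
      · exact absurd h (lt_irrefl _)
    set c := β * (δ * X ^ (δ - 1)) with hcdef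
    have hcpos : 0 < c := by positivity
    have hpd : HasDerivAt p (-c) X := by
      have h1 : HasDerivAt (fun q : ℝ => α - β * q ^ δ) (-c) X := by
        have := ((Real.hasDerivAt_rpow_const (x := X) (p := δ) (Or.inl hXpos.ne')).const_mul
          β).const_sub α
        simpa [hcdef] using this
      refine h1.congr_of_eventuallyEq ?_
      have h2 : ∀ᶠ q in nhds X, 0 < p q := (hpc.tendsto X).eventually (lt_mem_nhds hPX)
      filter_upwards [h2] with q hq
      rw [hpq] at hq ⊢
      rcases lt_max_iff.1 hq with h | h
      · exact max_eq_left h.le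
      · exact absurd h (lt_irrefl _)
    have hfoc : ∀ n z, 0 ≤ z → C n (x n) + (p X - c * x n) * (z - x n) ≤ C n z := by
      intro n z hz
      obtain ⟨hconv, -⟩ := hC n
      refine aux_foc (g := fun y => y * p (y + (X - x n))) hconv (hx0 n) hz ?_ ?_
      · intro y hy
        have := hxo n y hy
        rwa [hers] at this
      · have h1 : HasDerivAt (fun y : ℝ => y + (X - x n)) 1 (x n) :=
          (hasDerivAt_id (x n)).add_const _
        have h2 : HasDerivAt p (-c) (x n + (X - x n)) := by rwa [add_sub_cancel]
        have h3 := (hasDerivAt_id (x n)).mul (HasDerivAt.comp (x n) h2 h1)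
        have h4 : 1 * (p ∘ fun y : ℝ => y + (X - x n)) (x n) + id (x n) * (-c * 1)
            = p X - c * x n := by
          simp only [Function.comp, id, add_sub_cancel]
          ring
        rw [h4] at h3
        exact h3
    obtain ⟨n0, -, hmax⟩ := Finset.exists_max_image Finset.univ x ⟨⟨0, hN⟩, Finset.mem_univ _⟩
    set m := x n0 with hm
    have hmpos : 0 < m := by
      by_contra hcon
      have : X ≤ 0 := by
        rw [← hXdef]
        exact Finset.sum_nonpos (fun n hn => (hmax n hn).trans (not_lt.1 hcon))
      linarith
    have hmX : m ≤ X := by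
      rw [← hXdef]
      exact Finset.single_le_sum (fun n _ => hx0 n) (Finset.mem_univ n0)
    have hPm : 0 ≤ p X - c * m := by
      have h1 := hfoc n0 0 le_rfl
      obtain ⟨-, -, -, -, -, -, h0⟩ := hC n0
      have h2 := hCn n0 m hmpos.le
      rw [h0] at h1
      rw [← hm] at h1
      by_contra hcon
      push Not at hcon
      nlinarith
    set Q := ∑ n, x n ^ 2 with hQ
    have hQm : m ^ 2 ≤ Q :=
      Finset.single_le_sum (f := fun n => x n ^ 2) (fun n _ => sq_nonneg _) (Finset.mem_univ n0)
    set Tc := ∑ n, C n (x n) with hTc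
    -- lower bound for the welfare at x
    have hcost : Tc ≤ p X * X - c * Q := by
      have : Tc ≤ ∑ n, (p X * x n - c * x n ^ 2) := by
        apply Finset.sum_le_sum
        intro n _
        have h1 := hfoc n 0 le_rfl
        obtain ⟨-, -, -, -, -, -, h0⟩ := hC n
        rw [h0] at h1
        linarith
      rwa [Finset.sum_sub_distrib, ← Finset.mul_sum, ← Finset.mul_sum, hXdef] at this
    have hIlow : p X * X + c * X ^ 2 / 2 ≤ ∫ q in (0:ℝ)..X, p q := by
      have h1 : ∫ q in (0:ℝ)..X, (p X + c * (X - q)) = p X * X + c * X ^ 2 / 2 := by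
        rw [intervalIntegral.integral_add (by simp)
          (Continuous.intervalIntegrable (by fun_prop) _ _), intervalIntegral.integral_const_mul,
          intervalIntegral.integral_sub (by simp) (by simp)]
        simp
        ring
      rw [← h1]
      refine intervalIntegral.integral_mono_on hX0
        (Continuous.intervalIntegrable (by fun_prop) _ _) (hpi _ _) (fun q hq => ?_)
      have h2 := aux_tangent hδ0 hδ1 hq.1 hXpos
      have h3 := hpge q
      rw [hP]
      have h4 := mul_le_mul_of_nonneg_left h2 hβ.le
      have h5 : β * (X ^ δ + δ * X ^ (δ - 1) * (q - X)) = β * X ^ δ - c * (X - q) := by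
        rw [hcdef]; ring
      linarith
    have hSWx : SW C p x = (∫ q in (0:ℝ)..X, p q) - Tc := by
      unfold SW; rw [hXdef]
    -- upper bound for the welfare at xS
    have hcostS : Tc + p X * (S - X) - c * (m * S) + c * Q ≤ ∑ n, C n (xS n) := by
      have h1 : ∑ n, (C n (x n) + p X * xS n - p X * x n - c * (m * xS n) + c * x n ^ 2)
          ≤ ∑ n, C n (xS n) := by
        apply Finset.sum_le_sum
        intro n _
        have h1 := hfoc n (xS n) (hs0 n)
        have h2 := mul_le_mul_of_nonneg_left
          (mul_le_mul_of_nonneg_right (hmax n (Finset.mem_univ n)) (hs0 n)) hcpos.le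
        nlinarith
      rw [Finset.sum_add_distrib, Finset.sum_sub_distrib, Finset.sum_sub_distrib,
        Finset.sum_add_distrib, ← Finset.mul_sum, ← Finset.mul_sum, ← Finset.mul_sum,
        ← Finset.mul_sum, ← Finset.mul_sum, hXdef, hSdef] at h1
      linarith
    have hXX : X ^ (δ - 1) * X = X ^ δ := by
      nth_rewrite 2 [← Real.rpow_one X]
      rw [← Real.rpow_add hXpos]; simp
    have hI : ∫ q in X..S, (p q - (p X - c * m)) ≤ (c / K) * (K * m) ^ 2 / 2 := by
      apply aux_integral (by fun_prop) (by positivity) (by positivity) _ hS0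
      · intro q hq
        rcases le_total (α - β * q ^ δ) 0 with h | h
        · have : p q = 0 := by rw [hpq, max_eq_right h]
          rw [this]
          exact le_trans (by linarith) (le_max_right _ _)
        · have hpq' : p q = α - β * q ^ δ := by rw [hpq, max_eq_left h]
          rw [hpq', hP]
          rcases le_total (β * X ^ δ + c * m) (β * q ^ δ) with h2 | h2
          · exact le_trans (by linarith) (le_max_right _ _)
          · refine le_trans ?_ (le_max_left _ _)
            have h3 : q ^ δ ≤ (1 + δ) * X ^ δ := by
              have : c * m ≤ c * X := by gcongr
              have h4 : c * X = β * (δ * X ^ δ) := by rw [hcdef, ← hXX]; ring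
              rw [h4] at this
              have : β * q ^ δ ≤ β * ((1 + δ) * X ^ δ) := by linarith
              exact le_of_mul_le_mul_left this hβ
            have h4 := mul_le_mul_of_nonneg_left (aux_gap hδ0 hδ1 hXpos hq h3) hβ.le
            rw [← hK] at h4
            have h5 : c * (q - X) ≤ K * (β * q ^ δ - β * X ^ δ) := by
              rw [hcdef]; linarith
            have h6 : c / K * (q - X) ≤ β * q ^ δ - β * X ^ δ := by
              rw [div_mul_eq_mul_div, div_le_iff₀ hKpos]; linarith
            have h7 : c / K * (X + K * m - q) = c * m - c / K * (q - X) := by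
              field_simp; ring
            rw [h7]; linarith
      · intro q hq hqX
        have := hanti q X hq hqX
        have : 0 ≤ c * m := by positivity
        linarith
    rw [intervalIntegral.integral_sub (hpi _ _) (by simp), intervalIntegral.integral_const,
      smul_eq_mul] at hI
    have hKm : (c / K) * (K * m) ^ 2 / 2 = c * (K * m ^ 2) / 2 := by field_simp
    rw [hKm] at hI
    have hsplit := intervalIntegral.integral_add_adjacent_intervals (hpi 0 X) (hpi X S)
    have hSWS2 : SW C p xS = (∫ q in (0:ℝ)..S, p q) - ∑ n, C n (xS n) := by
      unfold SW; rw [hSdef]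
    have hQ0 : 0 ≤ c * Q := mul_nonneg hcpos.le ((sq_nonneg m).trans hQm)
    have hcX : 0 < c * X ^ 2 / 2 := by positivity
    have hA : c * X ^ 2 / 2 + c * Q ≤ SW C p x := by rw [hSWx]; linarith
    have hB : SW C p xS ≤ SW C p x + (c * (K * m ^ 2) / 2 + c * (m * X) - c * Q) := by
      rw [hSWS2, hSWx]; linarith
    refine ⟨by linarith, ?_⟩
    have hF := mul_le_mul_of_nonneg_left (aux_f hKpos hmpos hmX) hcpos.le
    have h1 := mul_le_mul_of_nonneg_left hB hf0
    have h2 : 0 ≤ (1 - fbound K) * (SW C p x - (c * X ^ 2 / 2 + c * Q)) :=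
      mul_nonneg (by linarith) (by linarith)
    have h3 := mul_le_mul_of_nonneg_left hQm hcpos.le
    linarith

end
end

section
/- Suppose Assumptions 1, 3 and 4 hold, the inverse demand function is p(q) = α(Q − q)^β for 0 ≤ q ≤ Q and p(q) = 0 for q > Q, where Q > 0, α > 0 and β ≥ 1, and there is a best supplier whose cost function is linear with slope c > 0 (that is, some supplier k with C_k(z) = c·z for all z ≥ 0 and C_k'(z) ≤ C_m'(z) for every supplier m and every z > 0), where c < α·Q^β. Then every Cournot equilibrium x with aggregate supply X ≤ Q and p(X) ≠ p(X^S) for a social optimum x^S satisfies γ(x) ≥ f((p(X)/c)^{(β−1)/β}). -/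
open Finset Set

noncomputable section

lemma aux_poly (r X y : ℝ) (hr : 0 ≤ r) (hy : 0 ≤ y) (hyX : y ≤ X) :
    (phi r ^ 2 + 2) * (X ^ 2 + 2 * y * X + r * y ^ 2) ≤
      (X ^ 2 + 2 * y ^ 2) * (phi r ^ 2 + 2 * phi r + r) := by
  set w := Real.sqrt (r ^ 2 - 4 * r + 12) with hw
  have hw0 : 0 ≤ w := Real.sqrt_nonneg _
  have hw2 : w ^ 2 = r ^ 2 - 4 * r + 12 := Real.sq_sqrt (by nlinarith [sq_nonneg (r - 2)])
  rcases le_total ((2 - r + w) / 2) 1 with h | h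
  · have hphi : phi r = 1 := by unfold phi; rw [max_eq_right h]
    rw [hphi]
    have hr3 : 3 ≤ r := by
      by_contra hlt
      push Not at hlt
      nlinarith
    have h1 : 0 ≤ (X - y) * (2 * X + (r - 2) * (X + y) - 4 * y) := by
      apply mul_nonneg (by linarith)
      nlinarith
    nlinarith
  · have hphi : phi r = (2 - r + w) / 2 := by unfold phi; rw [max_eq_left h]
    set f := phi r
    have hf : f ^ 2 = 2 - (r - 2) * f := by rw [hphi]; nlinarith
    have hw' : w = 2 * f + r - 2 := by rw [hphi]; ring
    have h1 : 0 ≤ (X - f * y) ^ 2 * w := by positivity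
    rw [hw'] at h1
    have : (X ^ 2 + 2 * y ^ 2) * (f ^ 2 + 2 * f + r) - (f ^ 2 + 2) * (X ^ 2 + 2 * y * X + r * y ^ 2)
      = (X - f * y) ^ 2 * (2 * f + r - 2) := by
      linear_combination (2 * y * (X - f * y)) * hf
    linarith

lemma aux_final (r X y s δ D W V : ℝ) (hr : 0 ≤ r) (hy : 0 ≤ y) (hyX : y ≤ X) (hs : 0 < s)
    (hδ : δ ≤ r * y) (hD : s * X ^ 2 / 2 ≤ D) (hW : W ≤ D + s * y * X + s * y * δ / 2)
    (hV : D + s * y ^ 2 ≤ V) (hW0 : 0 < W) : fbound r ≤ V / W := by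
  have hphi : 1 ≤ phi r := le_max_right _ _
  have hp := aux_poly r X y hr hy hyX
  unfold fbound
  have hden : 0 < phi r ^ 2 + 2 * phi r + r := by positivity
  rw [div_le_div_iff₀ hden hW0]
  have h1 : W ≤ D + s * y * X + s * y * (r * y) / 2 := by
    have := mul_le_mul_of_nonneg_left hδ (mul_nonneg hs.le hy)
    linarith
  have h2 := mul_le_mul_of_nonneg_left h1 (show (0:ℝ) ≤ phi r ^ 2 + 2 by positivity)
  have h3 := mul_le_mul_of_nonneg_right hV hden.le
  have h4 := mul_le_mul_of_nonneg_left hp hs.le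
  have h5 : 0 ≤ (D - s * X ^ 2 / 2) * (2 * phi r + r - 2) :=
    mul_nonneg (by linarith) (by linarith)
  nlinarith

lemma aux_tangent_s19 (β u v : ℝ) (hβ : 1 ≤ β) (hu : 0 ≤ u) (hv : 0 < v) :
    v ^ β + β * v ^ (β - 1) * (u - v) ≤ u ^ β := by
  have h := one_add_mul_self_le_rpow_one_add (s := u / v - 1) (by
    have : 0 ≤ u / v := by positivity
    linarith) hβ
  have e : 1 + (u / v - 1) = u / v := by ring
  rw [e, Real.div_rpow hu hv.le, le_div_iff₀ (by positivity)] at h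
  have e2 : v ^ β = v ^ (β - 1) * v := by
    rw [← Real.rpow_add_one hv.ne']; ring_nf
  refine le_trans (le_of_eq ?_) h
  rw [e2]; field_simp

lemma aux_cost (C C' : ℝ → ℝ) (c : ℝ) (h : CostAssumption C C') (hc : ∀ z, 0 < z → c ≤ C' z)
    (z : ℝ) (hz : 0 ≤ z) : c * z ≤ C z := by
  obtain ⟨-, hcont, -, hd, -, -, h0⟩ := h
  have hm : MonotoneOn (fun z => C z - c * z) (Set.Ici 0) := by
    apply monotoneOn_of_deriv_nonneg (convex_Ici 0)
    · exact hcont.sub (by fun_prop)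
    · intro t ht
      rw [interior_Ici] at ht
      exact ((hd t ht).sub ((hasDerivAt_id t).const_mul c)).differentiableAt.differentiableWithinAt
    · intro t ht
      rw [interior_Ici] at ht
      have := ((hd t ht).sub ((hasDerivAt_id t).const_mul c)).deriv
      have e : deriv (fun z => C z - c * z) t = C' t - c * 1 := this
      rw [e]
      linarith [hc t ht]
  have := hm (Set.mem_Ici.2 le_rfl) hz hz
  simp only [h0] at this
  linarith

set_option maxHeartbeats 1000000 in
/-- Efficiency bound for the inverse demand `p(q) = α (Q - q)^β` (for `0 ≤ q ≤ Q`)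
with a best supplier having linear cost with slope `c`:
`γ(x) ≥ f((p(X)/c)^((β-1)/β))`. -/
theorem efficiency_bound_FW09_demand {N : ℕ} (hN : 0 < N)
    (C C' : Fin N → ℝ → ℝ) (Q α β c : ℝ)
    (hQ : 0 < Q) (hα : 0 < α) (hβ : 1 ≤ β) (hc : 0 < c)
    (hC : ∀ n, CostAssumption (C n) (C' n))
    (p : ℝ → ℝ) (hp : p = fun q => if q ≤ Q then α * (Q - q) ^ β else 0)
    (hA3 : ∃ R : ℝ, 0 < R ∧ ∀ n, p R ≤ C' n 0)
    (hA4 : ∃ n, C' n 0 < p 0)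
    (hcQ : c < α * Q ^ β)
    (k : Fin N) (hk : ∀ z : ℝ, C k z = c * z)
    (hbest : ∀ m : Fin N, ∀ z : ℝ, 0 < z → C' k z ≤ C' m z)
    (x xS : Fin N → ℝ)
    (hx : CournotEquilibrium C p x)
    (hXQ : (∑ n, x n) ≤ Q)
    (hxS : SocialOptimum C p xS)
    (hne : p (∑ n, x n) ≠ p (∑ n, xS n)) :
    fbound ((p (∑ n, x n) / c) ^ ((β - 1) / β)) ≤ SW C p x / SW C p xS := by
  have hβ0 : 0 < β := by linarith
  have hpQ : ∀ q, q ≤ Q → p q = α * (Q - q) ^ β := by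
    intro q hq; rw [hp]; simp [hq]
  have hpe : p = fun q => α * (max (Q - q) 0) ^ β := by
    rw [hp]; ext q
    split_ifs with h
    · rw [max_eq_left (by linarith)]
    · rw [max_eq_right (by linarith), Real.zero_rpow hβ0.ne', mul_zero]
  have hpcont : Continuous p := by
    rw [hpe]
    exact continuous_const.mul (Continuous.rpow_const (by fun_prop) (fun _ => Or.inr hβ0.le))
  have hpanti : Antitone p := by
    rw [hpe]
    intro a b hab
    have : max (Q - b) 0 ≤ max (Q - a) 0 := max_le_max (by linarith) le_rfl
    exact mul_le_mul_of_nonneg_left (Real.rpow_le_rpow (le_max_right _ _) this hβ0.le) hα.le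
  have hpint : ∀ a b, IntervalIntegrable p MeasureTheory.volume a b :=
    fun a b => hpcont.intervalIntegrable a b
  have hCk' : ∀ z, 0 < z → C' k z = c := by
    intro z hz
    have h1 := (hC k).2.2.2.1 z hz
    have h2 : HasDerivAt (C k) (c * 1) z := by
      have : C k = fun z => c * z := funext hk
      rw [this]
      exact (hasDerivAt_id z).const_mul c
    have := h1.unique h2
    linarith
  have hCc : ∀ n z, 0 ≤ z → c * z ≤ C n z := fun n z hz =>
    aux_cost (C n) (C' n) c (hC n) (fun t ht => by rw [← hCk' t ht]; exact hbest n t ht) z hz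
  obtain ⟨hx0, hxeq⟩ := hx
  have hsum : ∀ n, x n + ∑ m ∈ Finset.univ.erase n, x m = ∑ m, x m :=
    fun n => Finset.add_sum_erase _ _ (Finset.mem_univ n)
  have hxk : x k ≤ ∑ n, x n := Finset.single_le_sum (fun i _ => hx0 i) (Finset.mem_univ k)
  have hX0 : 0 ≤ ∑ n, x n := Finset.sum_nonneg (fun i _ => hx0 i)
  have hprofit : ∀ n, C n (x n) ≤ x n * p (∑ m, x m) := by
    intro n
    have := hxeq n 0 le_rfl
    rw [hsum n, (hC n).2.2.2.2.2.2] at this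
    linarith
  have hVlow : (∫ q in (0:ℝ)..(∑ n, x n), p q) - p (∑ n, x n) * (∑ n, x n)
      + (p (∑ n, x n) - c) * x k ≤ SW C p x := by
    unfold SW
    have h1 : ∑ n, C n (x n) = C k (x k) + ∑ n ∈ Finset.univ.erase k, C n (x n) :=
      (Finset.add_sum_erase _ (fun n => C n (x n)) (Finset.mem_univ k)).symm
    have h2 : ∑ n ∈ Finset.univ.erase k, C n (x n) ≤
        ∑ n ∈ Finset.univ.erase k, x n * p (∑ m, x m) :=
      Finset.sum_le_sum (fun n _ => hprofit n)
    rw [← Finset.sum_mul] at h2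
    have h3 : ∑ n ∈ Finset.univ.erase k, x n = ∑ m, x m - x k := by linarith [hsum k]
    rw [h1, hk]
    rw [h3] at h2
    nlinarith
  have hp0 : p 0 = α * Q ^ β := by rw [hpQ 0 hQ.le, sub_zero]
  have hPc : c ≤ p (∑ n, x n) := by
    by_contra hlt
    push Not at hlt
    have hXpos : 0 < ∑ n, x n := by
      rcases hX0.lt_or_eq with h | h
      · exact h
      · rw [← h, hp0] at hlt; linarith
    obtain ⟨n, -, hn⟩ := Finset.exists_lt_of_sum_lt (s := Finset.univ) (f := fun _ : Fin N => (0:ℝ))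
      (g := x) (by simpa using hXpos)
    have h1 := hprofit n
    have h2 := hCc n (x n) (hx0 n)
    nlinarith
  have hk1 := hxeq k
  rw [hsum k] at hk1
  have hSk := hsum k
  have hSWle : SW C p x ≤ SW C p xS := hxS.2 x hx0
  have hWup : SW C p xS ≤ (∫ q in (0:ℝ)..(∑ n, xS n), p q) - c * ∑ n, xS n := by
    unfold SW
    rw [Finset.mul_sum]
    have := Finset.sum_le_sum (s := Finset.univ) (fun n _ => hCc n (xS n) (hxS.1 n))
    linarith
  generalize (∑ n, xS n) = Y at *
  generalize (∑ m ∈ Finset.univ.erase k, x m) = S at *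
  generalize (∑ n, x n) = X at *
  have hXQ' : X < Q := by
    rcases hXQ.lt_or_eq with h | h
    · exact h
    · rw [hpQ X hXQ, h, sub_self, Real.zero_rpow hβ0.ne'] at hPc; linarith
  have htan : ∀ a q, a < Q → q ≤ Q → p a - α * (β * (Q - a) ^ (β - 1)) * (q - a) ≤ p q := by
    intro a q ha hq
    rw [hpQ a ha.le, hpQ q hq]
    have := aux_tangent_s19 β (Q - q) (Q - a) hβ (by linarith) (by linarith)
    have := mul_le_mul_of_nonneg_left this hα.le
    linarith
  have hspos : ∀ a, a < Q → 0 < α * (β * (Q - a) ^ (β - 1)) := by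
    intro a ha
    have : 0 < Q - a := by linarith
    positivity
  -- the point where price equals c
  set v := (c / α) ^ (1 / β) with hv
  have hv0 : 0 < v := by positivity
  have hvβ : v ^ β = c / α := by
    rw [hv, ← Real.rpow_mul (by positivity), one_div, inv_mul_cancel₀ hβ0.ne', Real.rpow_one]
  have hpT : p (Q - v) = c := by
    rw [hpQ _ (by linarith), sub_sub_cancel, hvβ]; field_simp
  have hXT : X ≤ Q - v := by
    by_contra h
    push Not at h
    have : (Q - X) ^ β < v ^ β := Real.rpow_lt_rpow (by linarith) (by linarith) hβ0
    rw [hpQ X hXQ, ] at hPc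
    rw [hvβ, lt_div_iff₀ hα] at this
    linarith
  set s := α * (β * (Q - X) ^ (β - 1)) with hs
  have hs0 : 0 < s := hspos X hXQ'
  have hFOC : p X - c ≤ s * x k := by
    by_contra hlt
    push Not at hlt
    obtain ⟨ε, hε0, hε1, hε2⟩ : ∃ ε, 0 < ε ∧ ε ≤ Q - X ∧ s * ε < p X - c - s * x k := by
      refine ⟨min (Q - X) ((p X - c - s * x k) / (2 * s)), lt_min (by linarith)
        (div_pos (by linarith) (by linarith)), min_le_left _ _, ?_⟩
      have h1 := min_le_right (Q - X) ((p X - c - s * x k) / (2 * s))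
      have h2 := mul_le_mul_of_nonneg_left h1 hs0.le
      have h3 : s * ((p X - c - s * x k) / (2 * s)) = (p X - c - s * x k) / 2 := by field_simp
      linarith
    have h1 := hk1 (x k + ε) (by linarith [hx0 k])
    have e : x k + ε + S = X + ε := by linarith
    rw [e, hk, hk] at h1
    have h2 := htan X (X + ε) hXQ' (by linarith)
    have h3 := mul_le_mul_of_nonneg_left h2 (show 0 ≤ x k + ε by linarith [hx0 k])
    rw [← hs] at h3
    have h4 : 0 < ε * (p X - c - s * x k - s * ε) := mul_pos hε0 (by linarith)
    nlinarith
  have hD : s * X ^ 2 / 2 ≤ (∫ q in (0:ℝ)..X, p q) - p X * X := by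
    have h1 : (∫ q in (0:ℝ)..X, (p X + s * X - s * q)) ≤ ∫ q in (0:ℝ)..X, p q := by
      apply intervalIntegral.integral_mono_on hX0 (Continuous.intervalIntegrable (by fun_prop) _ _)
        (hpint _ _)
      intro q hq
      have := htan X q hXQ' (by linarith [hq.2])
      linarith
    have h2 : (∫ q in (0:ℝ)..X, (p X + s * X - s * q)) = (p X + s * X) * X - s * X ^ 2 / 2 := by
      rw [intervalIntegral.integral_sub (by simp) (Continuous.intervalIntegrable (by fun_prop) _ _),
        intervalIntegral.integral_const, intervalIntegral.integral_const_mul, integral_id]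
      simp; ring
    linarith
  have hchord : (∫ q in X..(Q - v), p q) ≤ (p X + c) / 2 * (Q - v - X) := by
    rcases hXT.lt_or_eq with hlt | heq
    · set δ := Q - v - X with hδ
      have hδ0 : 0 < δ := by linarith
      set m := (p X - c) / δ with hm
      have hmδ : m * δ = p X - c := by rw [hm]; field_simp
      have h1 : (∫ q in X..(Q - v), p q) ≤ (∫ q in X..(Q - v), (p X + m * X - m * q)) := by
        apply intervalIntegral.integral_mono_on hXT (hpint _ _)
          (Continuous.intervalIntegrable (by fun_prop) _ _)
        intro q hq
        have hcv : ∀ u : ℝ, 0 ≤ u → ∀ w : ℝ, 0 ≤ w → ∀ a b : ℝ, 0 ≤ a → 0 ≤ b → a + b = 1 →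
            (a • u + b • w) ^ β ≤ a • u ^ β + b • w ^ β :=
          fun u hu w hw a b ha hb hab => (convexOn_rpow hβ).2 hu hw ha hb hab
        have hconv := hcv (Q - X) (by linarith) v hv0.le ((Q - v - q) / δ) ((q - X) / δ)
          (div_nonneg (by linarith [hq.2]) hδ0.le) (div_nonneg (by linarith [hq.1]) hδ0.le)
          (by rw [← add_div, div_eq_one_iff_eq hδ0.ne']; rw [hδ]; ring)
        have e : ((Q - v - q) / δ) • (Q - X) + ((q - X) / δ) • v = Q - q := by
          simp only [smul_eq_mul]; field_simp; rw [hδ]; ring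
        rw [e] at hconv
        simp only [smul_eq_mul] at hconv
        have h2 := mul_le_mul_of_nonneg_left hconv hα.le
        rw [← hpQ q (by linarith [hq.2])] at h2
        refine h2.trans (le_of_eq ?_)
        have e1 := hpQ X hXQ
        have e2 : c = α * v ^ β := by rw [hvβ]; field_simp
        calc α * ((Q - v - q) / δ * (Q - X) ^ β + (q - X) / δ * v ^ β)
            = (Q - v - q) / δ * (α * (Q - X) ^ β) + (q - X) / δ * (α * v ^ β) := by ring
          _ = (Q - v - q) / δ * p X + (q - X) / δ * c := by rw [← e1, ← e2]
          _ = _ := by rw [hm]; field_simp; rw [hδ]; ring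
      have h2 : (∫ q in X..(Q - v), (p X + m * X - m * q))
          = (p X + m * X) * (Q - v - X) - m * ((Q - v) ^ 2 - X ^ 2) / 2 := by
        rw [intervalIntegral.integral_sub (by simp)
          (Continuous.intervalIntegrable (by fun_prop) _ _),
          intervalIntegral.integral_const, intervalIntegral.integral_const_mul, integral_id]
        simp; ring
      have h3 : (p X + m * X) * (Q - v - X) - m * ((Q - v) ^ 2 - X ^ 2) / 2 =
          p X * δ - m * δ * δ / 2 := by rw [hδ]; ring
      rw [hmδ] at h3
      linarith
    · rw [← heq]; simp
  have htail : (∫ q in (Q - v)..Y, p q) ≤ c * (Y - (Q - v)) := by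
    rcases le_total (Q - v) Y with h | h
    · have := intervalIntegral.integral_mono_on (μ := MeasureTheory.volume) h (hpint _ _)
        (g := fun _ => c) (by simp) (fun q hq => by rw [← hpT]; exact hpanti hq.1)
      simp only [intervalIntegral.integral_const, smul_eq_mul] at this
      linarith
    · have := intervalIntegral.integral_mono_on (μ := MeasureTheory.volume) h
        (f := fun _ => c) (by simp) (hpint _ _) (fun q hq => by rw [← hpT]; exact hpanti hq.2)
      simp only [intervalIntegral.integral_const, smul_eq_mul] at this
      rw [intervalIntegral.integral_symm]
      linarith
  have hsplit : (∫ q in (0:ℝ)..Y, p q) = (∫ q in (0:ℝ)..X, p q) + (∫ q in X..(Q - v), p q)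
      + ∫ q in (Q - v)..Y, p q := by
    rw [intervalIntegral.integral_add_adjacent_intervals (hpint _ _) (hpint _ _),
      intervalIntegral.integral_add_adjacent_intervals (hpint _ _) (hpint _ _)]
  have hu0 : 0 < Q - X := by linarith
  have hr : (p X / c) ^ ((β - 1) / β) = (Q - X) ^ (β - 1) / v ^ (β - 1) := by
    have e : p X / c = ((Q - X) / v) ^ β := by
      rw [Real.div_rpow hu0.le hv0.le, hvβ, hpQ X hXQ]; field_simp
    rw [e, ← Real.rpow_mul (by positivity), mul_div_cancel₀ _ hβ0.ne',
      Real.div_rpow hu0.le hv0.le]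
  have hr0 : 0 ≤ (p X / c) ^ ((β - 1) / β) := by rw [hr]; positivity
  set y := (p X - c) / s with hy
  have hsy : s * y = p X - c := by rw [hy]; field_simp
  have hy0 : 0 ≤ y := div_nonneg (by linarith) hs0.le
  have hyk : y ≤ x k := by
    rw [hy, div_le_iff₀ hs0]; linarith
  have hδr : Q - v - X ≤ (p X / c) ^ ((β - 1) / β) * y := by
    have h1 := htan (Q - v) X (by linarith) hXQ
    rw [hpT, sub_sub_cancel] at h1
    have hvp : 0 < v ^ (β - 1) := by positivity
    have h2 : s = (p X / c) ^ ((β - 1) / β) * (α * (β * v ^ (β - 1))) := by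
      rw [hr, hs]; field_simp
    have h3 : (p X / c) ^ ((β - 1) / β) * (α * (β * v ^ (β - 1)) * (Q - v - X)) ≤
        (p X / c) ^ ((β - 1) / β) * (p X - c) := mul_le_mul_of_nonneg_left (by linarith) hr0
    rw [← hsy, ← mul_assoc, ← h2] at h3
    refine le_of_mul_le_mul_left (h3.trans (le_of_eq (by ring))) hs0
  have hV : (∫ q in (0:ℝ)..X, p q) - p X * X + s * y ^ 2 ≤ SW C p x := by
    have : s * y * y ≤ s * y * x k := mul_le_mul_of_nonneg_left hyk (by positivity)
    nlinarith
  have hVpos : 0 < SW C p x := by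
    have hXpos : 0 < X := by
      rcases hX0.lt_or_eq with h | h
      · exact h
      · exfalso
        have : y ≤ 0 := by linarith
        rw [← h, hp0] at hsy
        have := mul_nonpos_of_nonneg_of_nonpos hs0.le this
        linarith
    have : 0 < s * X ^ 2 / 2 := by positivity
    have : 0 ≤ s * y ^ 2 := by positivity
    linarith
  refine aux_final _ X y s (Q - v - X) ((∫ q in (0:ℝ)..X, p q) - p X * X) _ _ hr0 hy0
    (hyk.trans hxk) hs0 hδr hD ?_ hV (hVpos.trans_le hSWle)
  rw [hsy]
  linarith

end
end
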